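/- arXiv:1308.1566 — 2 statements merged into one kernel-verified Lean document; each statement's English description precedes it below -/
import Mathlib

section
/- Let f₀ := x¹⁰ + a₁x⁹ + a₂x⁸ + a₃x⁷ + a₄x⁶ + a₅x⁵ + a₆x⁴ + a₇x³ + a₈x² + a₉x + a₁₀, g₀ := x² − 6x + a₁₁, g₁ := x³ + a₁₂x² + a₁₃x + a₁₄, with a₁,…,a₁₄ the explicit rational functions in α given in the context, and set f(x, α, t) := f₀³·(x − 3) − t·g₀⁸·g₁⁴·x. Then f, viewed as a polynomial of degree 31 in x, is irreducible over the rational function field ℚ(α, t). -/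
/-!
Statement 1: the polynomial `f(x, α, t) = f₀³·(x−3) − t·g₀⁸·g₁⁴·x`, viewed as a polynomial
of degree 31 in `x`, is irreducible over the rational function field `ℚ(α, t)`.
We model `ℚ(α, t)` as `RatFunc (RatFunc ℚ)`, with `α = RatFunc.C RatFunc.X` and
`t = RatFunc.X` algebraically independent transcendentals over `ℚ`.
-/

open Polynomial

namespace PSL52Family

/-- The coefficient `a₁` as a rational function of `α`. -/
noncomputable def a1 {F : Type*} [Field F] (α : F) : F :=
  2 * (α^4 - 37/2*α^3 - 3*α^2 - 109/2*α + 91) / ((α - 2) * (α + 1)^2)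

/-- The coefficient `a₂` as a rational function of `α`. -/
noncomputable def a2 {F : Type*} [Field F] (α : F) : F :=
  -12 * ((α^2 - 5/2*α - 8) * (α^3 + 10*α^2 + 17*α + 44)) / ((α - 2) * (α + 1) * (α + 4))

/-- The coefficient `a₃` as a rational function of `α`. -/
noncomputable def a3 {F : Type*} [Field F] (α : F) : F :=
  -8 * (α^6 - 93/2*α^5 - 261/2*α^4 - 1343/2*α^3 - 507/2*α^2 - 963*α + 3076) /
    ((α - 2) * (α + 1) * (α + 4))

/-- The coefficient `a₄` as a rational function of `α`. -/
noncomputable def a4 {F : Type*} [Field F] (α : F) : F :=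
  62 * (α^9 + 159/31*α^8 - 1410/31*α^7 - 3834/31*α^6 - 987*α^5 - 52905/31*α^4 - 72480/31*α^3
      - 50196/31*α^2 + 256224/31*α - 56384/31) / ((α - 2)^2 * (α + 1) * (α + 4)^2)

/-- The coefficient `a₅` as a rational function of `α`. -/
noncomputable def a5 {F : Type*} [Field F] (α : F) : F :=
  -36 * (α^9 + 241/6*α^8 + 226/3*α^7 + 521/3*α^6 + 1483/3*α^5 - 19319/6*α^4 - 12872/3*α^3
      - 58186/3*α^2 - 51344/3*α + 30944/3) / ((α - 2)^2 * (α + 4)^2)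

/-- The coefficient `a₆` as a rational function of `α`. -/
noncomputable def a6 {F : Type*} [Field F] (α : F) : F :=
  -92 * ((α + 1)^2 * (α^7 - 337/23*α^6 - 237/23*α^5 - 2075/23*α^4 - 7724/23*α^3 + 2166/23*α^2
      - 35740/23*α + 44048/23)) / ((α - 2)^2 * (α + 4))

/-- The coefficient `a₇` as a rational function of `α`. -/
noncomputable def a7 {F : Type*} [Field F] (α : F) : F :=
  152 * ((α + 1)^3 * (α^7 + 5/38*α^6 - 489/38*α^5 - 407/38*α^4 - 4367/38*α^3 - 3768/19*α^2
      - 2882/19*α - 23192/19)) / ((α - 2)^2 * (α + 4))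

/-- The coefficient `a₈` as a rational function of `α`. -/
noncomputable def a8 {F : Type*} [Field F] (α : F) : F :=
  -87 * ((α + 1)^4 * (α^6 + 96/29*α^5 + 66/29*α^4 + 532/29*α^3 - 3/29*α^2 + 300/29*α + 4724/29)) /
    ((α - 2)^2)

/-- The coefficient `a₉` as a rational function of `α`. -/
noncomputable def a9 {F : Type*} [Field F] (α : F) : F :=
  18 * ((α + 1)^6 * (α^5 + 53/6*α^4 + 70/3*α^3 + 111/2*α^2 + 376/3*α + 94/3)) / ((α - 2)^2)

/-- The coefficient `a₁₀` as a rational function of `α`. -/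
noncomputable def a10 {F : Type*} [Field F] (α : F) : F :=
  -6 * ((α + 1)^9 * (α + 4)) / (α - 2)

/-- The coefficient `a₁₁` as a rational function of `α`. -/
noncomputable def a11 {F : Type*} [Field F] (α : F) : F := -(α + 1)^2

/-- The coefficient `a₁₂` as a rational function of `α`. -/
noncomputable def a12 {F : Type*} [Field F] (α : F) : F :=
  (α + 1) * (α^2 - 16*α - 8) / ((α - 2) * (α + 4))

/-- The coefficient `a₁₃` as a rational function of `α`. -/
noncomputable def a13 {F : Type*} [Field F] (α : F) : F := -3*(α + 1)^2

/-- The coefficient `a₁₄` as a rational function of `α`. -/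
noncomputable def a14 {F : Type*} [Field F] (α : F) : F := (α + 1)^3 * (α + 4) / (α - 2)

/-- `f₀ = x¹⁰ + a₁x⁹ + ⋯ + a₁₀`. -/
noncomputable def f0 {F : Type*} [Field F] (α : F) : Polynomial F :=
  X^10 + C (a1 α) * X^9 + C (a2 α) * X^8 + C (a3 α) * X^7 + C (a4 α) * X^6 + C (a5 α) * X^5
    + C (a6 α) * X^4 + C (a7 α) * X^3 + C (a8 α) * X^2 + C (a9 α) * X + C (a10 α)

/-- `g₀ = x² − 6x + a₁₁`. -/
noncomputable def g0 {F : Type*} [Field F] (α : F) : Polynomial F :=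
  X^2 - 6*X + C (a11 α)

/-- `g₁ = x³ + a₁₂x² + a₁₃x + a₁₄`. -/
noncomputable def g1 {F : Type*} [Field F] (α : F) : Polynomial F :=
  X^3 + C (a12 α) * X^2 + C (a13 α) * X + C (a14 α)

/-- The family `f(x, α, t) = f₀³·(x − 3) − t·g₀⁸·g₁⁴·x`, as a polynomial in `x` over `F`,
where `α, t : F`. -/
noncomputable def fFamily {F : Type*} [Field F] (α t : F) : Polynomial F :=
  (f0 α)^3 * (X - 3) - C t * (g0 α)^8 * (g1 α)^4 * X

theorem f0_map {F G : Type*} [Field F] [Field G] (φ : F →+* G) (α : F) :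
    (f0 α).map φ = f0 (φ α) := by
  have h : ∀ (n : ℕ) [n.AtLeastTwo], φ (OfNat.ofNat n) = OfNat.ofNat n :=
    fun n _ => map_ofNat φ n
  simp [f0, a1, a2, a3, a4, a5, a6, a7, a8, a9, a10, h]

theorem g0_map {F G : Type*} [Field F] [Field G] (φ : F →+* G) (α : F) :
    (g0 α).map φ = g0 (φ α) := by
  simp [g0, a11]

theorem g1_map {F G : Type*} [Field F] [Field G] (φ : F →+* G) (α : F) :
    (g1 α).map φ = g1 (φ α) := by
  have h : ∀ (n : ℕ) [n.AtLeastTwo], φ (OfNat.ofNat n) = OfNat.ofNat n :=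
    fun n _ => map_ofNat φ n
  simp [g1, a12, a13, a14, h]

theorem f0_natDegree {F : Type*} [Field F] (α : F) : (f0 α).natDegree = 10 := by
  unfold f0
  compute_degree!

theorem f0_monic {F : Type*} [Field F] (α : F) : (f0 α).Monic := by
  unfold f0
  monicity!

theorem g0_natDegree {F : Type*} [Field F] (α : F) : (g0 α).natDegree = 2 := by
  unfold g0
  compute_degree!

theorem g0_monic {F : Type*} [Field F] (α : F) : (g0 α).Monic := by
  unfold g0
  monicity!

theorem g1_natDegree {F : Type*} [Field F] (α : F) : (g1 α).natDegree = 3 := by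
  unfold g1
  compute_degree!

theorem g1_monic {F : Type*} [Field F] (α : F) : (g1 α).Monic := by
  unfold g1
  monicity!

/-- The part of `fFamily α t` of degree `0` in `t`. -/
noncomputable def numer {F : Type*} [Field F] (α : F) : F[X] := (f0 α)^3 * (X - 3)

/-- The negative of the coefficient of `t` in `fFamily α t`. -/
noncomputable def denom {F : Type*} [Field F] (α : F) : F[X] := (g0 α)^8 * (g1 α)^4 * X

theorem fFamily_eq {F : Type*} [Field F] (α t : F) :
    fFamily α t = numer α - C t * denom α := by
  simp only [fFamily, numer, denom, mul_assoc]

theorem numer_map {F G : Type*} [Field F] [Field G] (φ : F →+* G) (α : F) :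
    (numer α).map φ = numer (φ α) := by
  simp [numer, f0_map]

theorem denom_map {F G : Type*} [Field F] [Field G] (φ : F →+* G) (α : F) :
    (denom α).map φ = denom (φ α) := by
  simp [denom, g0_map, g1_map]

theorem X_sub_three_monic {F : Type*} [Field F] : (X - 3 : F[X]).Monic :=
  monic_X_sub_C (3 : F)

theorem numer_monic {F : Type*} [Field F] (α : F) : (numer α).Monic :=
  ((f0_monic α).pow 3).mul X_sub_three_monic

theorem denom_monic {F : Type*} [Field F] (α : F) : (denom α).Monic :=
  (((g0_monic α).pow 8).mul ((g1_monic α).pow 4)).mul monic_X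

theorem numer_natDegree {F : Type*} [Field F] (α : F) : (numer α).natDegree = 31 := by
  rw [numer, ((f0_monic α).pow 3).natDegree_mul X_sub_three_monic,
    (f0_monic α).natDegree_pow, f0_natDegree, show (X - 3 : F[X]) = X - C 3 from rfl,
    natDegree_X_sub_C]

theorem denom_natDegree {F : Type*} [Field F] (α : F) : (denom α).natDegree = 29 := by
  rw [denom, (((g0_monic α).pow 8).mul ((g1_monic α).pow 4)).natDegree_mul monic_X,
    ((g0_monic α).pow 8).natDegree_mul ((g1_monic α).pow 4),
    (g0_monic α).natDegree_pow, (g1_monic α).natDegree_pow, g0_natDegree, g1_natDegree,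
    natDegree_X]

/-- The subring of `RatFunc k × k` consisting of the pairs `(r, r(c))` with `r` regular at `c`. -/
noncomputable def regularAt {k : Type*} [Field k] (c : k) : Subring (RatFunc k × k) where
  carrier := {z | ∃ p q : k[X], q.eval c ≠ 0 ∧ z.1 * algebraMap k[X] (RatFunc k) q =
    algebraMap k[X] (RatFunc k) p ∧ z.2 * q.eval c = p.eval c}
  zero_mem' := ⟨0, 1, by simp⟩
  one_mem' := ⟨1, 1, by simp⟩
  add_mem' := by
    rintro a b ⟨p, q, h, h1, h2⟩ ⟨p', q', h', h1', h2'⟩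
    refine ⟨p * q' + p' * q, q * q', by simp [h, h'], ?_, ?_⟩
    · simp only [map_add, map_mul, ← h1, ← h1', Prod.fst_add]
      ring
    · simp only [eval_add, eval_mul, ← h2, ← h2', Prod.snd_add]
      ring
  mul_mem' := by
    rintro a b ⟨p, q, h, h1, h2⟩ ⟨p', q', h', h1', h2'⟩
    refine ⟨p * p', q * q', by simp [h, h'], ?_, ?_⟩
    · simp only [map_mul, ← h1, ← h1', Prod.fst_mul]
      ring
    · simp only [eval_mul, ← h2, ← h2', Prod.snd_mul]
      ring
  neg_mem' := by
    rintro a ⟨p, q, h, h1, h2⟩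
    exact ⟨-p, q, h, by simp [← h1], by simp [← h2]⟩

section Specialization

variable {k : Type*} [Field k] {c : k}

theorem X_mem_regularAt : ((RatFunc.X, c) : RatFunc k × k) ∈ regularAt c :=
  ⟨X, 1, by simp⟩

theorem inv_mem_regularAt {a : RatFunc k} {b : k} (h : (a, b) ∈ regularAt c) (hb : b ≠ 0) :
    (a⁻¹, b⁻¹) ∈ regularAt c := by
  obtain ⟨p, q, hq, h1, h2⟩ := h
  have hp : p.eval c ≠ 0 := h2 ▸ mul_ne_zero hb hq
  have hq0 : algebraMap k[X] (RatFunc k) q ≠ 0 :=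
    RatFunc.algebraMap_ne_zero (by rintro rfl; simp at hq)
  have hp0 : algebraMap k[X] (RatFunc k) p ≠ 0 :=
    RatFunc.algebraMap_ne_zero (by rintro rfl; simp at hp)
  have ha : a ≠ 0 := by
    rintro rfl
    simp only [zero_mul] at h1
    exact hp0 h1.symm
  refine ⟨q, p, hp, ?_, ?_⟩
  · rw [← h1, inv_mul_cancel_left₀ ha]
  · rw [← h2, inv_mul_cancel_left₀ hb]

theorem div_mem_regularAt {a a' : RatFunc k} {b b' : k} (h : (a, b) ∈ regularAt c)
    (h' : (a', b') ∈ regularAt c) (hb : b' ≠ 0) : (a / a', b / b') ∈ regularAt c := by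
  rw [div_eq_mul_inv, div_eq_mul_inv]
  exact (regularAt c).mul_mem h (inv_mem_regularAt h' hb)

/-- The inclusion of the rational functions regular at `c` into `RatFunc k`. -/
noncomputable def toRatFunc (c : k) : regularAt c →+* RatFunc k :=
  (RingHom.fst (RatFunc k) k).comp (regularAt c).subtype

/-- The evaluation at `c` of the rational functions regular at `c`. -/
noncomputable def evalAt (c : k) : regularAt c →+* k :=
  (RingHom.snd (RatFunc k) k).comp (regularAt c).subtype

theorem regularAt_ext {x y : regularAt c} (h : toRatFunc c x = toRatFunc c y)
    (h' : evalAt c x = evalAt c y) : x = y :=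
  Subtype.ext (Prod.ext h h')

theorem isLocalHom_evalAt : IsLocalHom (evalAt c) where
  map_nonunit := by
    rintro ⟨⟨a, b⟩, h⟩ hu
    have hb : b ≠ 0 := IsUnit.ne_zero hu
    have ha : a ≠ 0 := by
      rintro rfl
      obtain ⟨p, q, hq, h1, h2⟩ := h
      have hp : p = 0 := by simpa using h1.symm
      simp [hp, hb, hq] at h2
    refine IsUnit.of_mul_eq_one ⟨(a⁻¹, b⁻¹), inv_mem_regularAt h hb⟩ ?_
    ext <;> simp [ha, hb]

/-- `p` has coefficients regular at `c`, and `q` is its specialization there. -/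
def Specializes (c : k) (p : (RatFunc k)[X]) (q : k[X]) : Prop :=
  ∃ r : (regularAt c)[X], r.map (toRatFunc c) = p ∧ r.map (evalAt c) = q

theorem monic_of_map_monic {r : (regularAt c)[X]} (h1 : (r.map (toRatFunc c)).Monic)
    (h2 : (r.map (evalAt c)).Monic)
    (h3 : (r.map (toRatFunc c)).natDegree = (r.map (evalAt c)).natDegree) : r.Monic := by
  have e1 := h1.coeff_natDegree
  have e2 := h2.coeff_natDegree
  rw [coeff_map] at e1 e2
  rw [← h3] at e2
  refine monic_of_natDegree_le_of_coeff_eq_one (r.map (toRatFunc c)).natDegree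
    (natDegree_le_iff_coeff_eq_zero.2 fun n hn => regularAt_ext ?_ ?_)
    (regularAt_ext (e1.trans (map_one _).symm) (e2.trans (map_one _).symm))
  · rw [← coeff_map, map_zero]
    exact coeff_eq_zero_of_natDegree_lt hn
  · rw [← coeff_map, map_zero]
    exact coeff_eq_zero_of_natDegree_lt (h3 ▸ hn)

namespace Specializes

variable {p p' : (RatFunc k)[X]} {q q' : k[X]}

theorem add (h : Specializes c p q) (h' : Specializes c p' q') :
    Specializes c (p + p') (q + q') := by
  obtain ⟨r, rfl, rfl⟩ := h
  obtain ⟨r', rfl, rfl⟩ := h'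
  exact ⟨r + r', by simp only [Polynomial.map_add], by simp only [Polynomial.map_add]⟩

theorem sub (h : Specializes c p q) (h' : Specializes c p' q') :
    Specializes c (p - p') (q - q') := by
  obtain ⟨r, rfl, rfl⟩ := h
  obtain ⟨r', rfl, rfl⟩ := h'
  exact ⟨r - r', by simp only [Polynomial.map_sub], by simp only [Polynomial.map_sub]⟩

theorem mul (h : Specializes c p q) (h' : Specializes c p' q') :
    Specializes c (p * p') (q * q') := by
  obtain ⟨r, rfl, rfl⟩ := h
  obtain ⟨r', rfl, rfl⟩ := h'
  exact ⟨r * r', by simp only [Polynomial.map_mul], by simp only [Polynomial.map_mul]⟩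

theorem pow (h : Specializes c p q) (n : ℕ) : Specializes c (p ^ n) (q ^ n) := by
  obtain ⟨r, rfl, rfl⟩ := h
  exact ⟨r ^ n, by simp only [Polynomial.map_pow], by simp only [Polynomial.map_pow]⟩

theorem X : Specializes c (X : (RatFunc k)[X]) X := ⟨Polynomial.X, by simp⟩

theorem ofNat (n : ℕ) [n.AtLeastTwo] :
    Specializes c (OfNat.ofNat n : (RatFunc k)[X]) (OfNat.ofNat n) :=
  ⟨OfNat.ofNat n, by simp⟩

theorem C {a : RatFunc k} {b : k} (h : (a, b) ∈ regularAt c) :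
    Specializes c (C a) (C b) :=
  ⟨Polynomial.C ⟨(a, b), h⟩, map_C _, map_C _⟩

/-- Coprimality of monic polynomials can be tested after specialization. -/
theorem isCoprime (h : Specializes c p q) (h' : Specializes c p' q') (hp : p.Monic)
    (hp' : p'.Monic) (hq : q.Monic) (hq' : q'.Monic) (hpq : p.natDegree = q.natDegree)
    (hpq' : p'.natDegree = q'.natDegree) (hc : IsCoprime q q') : IsCoprime p p' := by
  obtain ⟨r, rfl, rfl⟩ := h
  obtain ⟨r', rfl, rfl⟩ := h'
  have hr := monic_of_map_monic hp hq hpq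
  have hr' := monic_of_map_monic hp' hq' hpq'
  have := isLocalHom_evalAt (c := c)
  rw [← isUnit_resultant_iff_isCoprime hq, hr.natDegree_map, hr'.natDegree_map,
    resultant_map_map, isUnit_map_iff, isUnit_resultant_iff_isCoprime hr] at hc
  exact hc.map (mapRingHom (toRatFunc c))

end Specializes

end Specialization

theorem coeff_mem_regularAt_zero :
    ((a1 (RatFunc.X : RatFunc ℚ), a1 (0 : ℚ)) ∈ regularAt (0 : ℚ)) ∧
    ((a2 (RatFunc.X : RatFunc ℚ), a2 (0 : ℚ)) ∈ regularAt (0 : ℚ)) ∧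
    ((a3 (RatFunc.X : RatFunc ℚ), a3 (0 : ℚ)) ∈ regularAt (0 : ℚ)) ∧
    ((a4 (RatFunc.X : RatFunc ℚ), a4 (0 : ℚ)) ∈ regularAt (0 : ℚ)) ∧
    ((a5 (RatFunc.X : RatFunc ℚ), a5 (0 : ℚ)) ∈ regularAt (0 : ℚ)) ∧
    ((a6 (RatFunc.X : RatFunc ℚ), a6 (0 : ℚ)) ∈ regularAt (0 : ℚ)) ∧
    ((a7 (RatFunc.X : RatFunc ℚ), a7 (0 : ℚ)) ∈ regularAt (0 : ℚ)) ∧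
    ((a8 (RatFunc.X : RatFunc ℚ), a8 (0 : ℚ)) ∈ regularAt (0 : ℚ)) ∧
    ((a9 (RatFunc.X : RatFunc ℚ), a9 (0 : ℚ)) ∈ regularAt (0 : ℚ)) ∧
    ((a10 (RatFunc.X : RatFunc ℚ), a10 (0 : ℚ)) ∈ regularAt (0 : ℚ)) ∧
    ((a11 (RatFunc.X : RatFunc ℚ), a11 (0 : ℚ)) ∈ regularAt (0 : ℚ)) ∧
    ((a12 (RatFunc.X : RatFunc ℚ), a12 (0 : ℚ)) ∈ regularAt (0 : ℚ)) ∧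
    ((a13 (RatFunc.X : RatFunc ℚ), a13 (0 : ℚ)) ∈ regularAt (0 : ℚ)) ∧
    ((a14 (RatFunc.X : RatFunc ℚ), a14 (0 : ℚ)) ∈ regularAt (0 : ℚ)) := by
  have hadd : ∀ {a a' : RatFunc ℚ} {b b' : ℚ}, (a, b) ∈ regularAt (0 : ℚ) →
      (a', b') ∈ regularAt (0 : ℚ) → (a + a', b + b') ∈ regularAt (0 : ℚ) :=
    fun h h' => (regularAt (0 : ℚ)).add_mem h h'
  have hsub : ∀ {a a' : RatFunc ℚ} {b b' : ℚ}, (a, b) ∈ regularAt (0 : ℚ) →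
      (a', b') ∈ regularAt (0 : ℚ) → (a - a', b - b') ∈ regularAt (0 : ℚ) :=
    fun h h' => (regularAt (0 : ℚ)).sub_mem h h'
  have hmul : ∀ {a a' : RatFunc ℚ} {b b' : ℚ}, (a, b) ∈ regularAt (0 : ℚ) →
      (a', b') ∈ regularAt (0 : ℚ) → (a * a', b * b') ∈ regularAt (0 : ℚ) :=
    fun h h' => (regularAt (0 : ℚ)).mul_mem h h'
  have hneg : ∀ {a : RatFunc ℚ} {b : ℚ}, (a, b) ∈ regularAt (0 : ℚ) →
      (-a, -b) ∈ regularAt (0 : ℚ) := fun h => (regularAt (0 : ℚ)).neg_mem h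
  have hpow : ∀ {a : RatFunc ℚ} {b : ℚ} (n : ℕ), (a, b) ∈ regularAt (0 : ℚ) →
      (a ^ n, b ^ n) ∈ regularAt (0 : ℚ) := fun n h => (regularAt (0 : ℚ)).pow_mem h n
  have hone : ((1, 1) : RatFunc ℚ × ℚ) ∈ regularAt (0 : ℚ) := (regularAt (0 : ℚ)).one_mem
  have hnat : ∀ (n : ℕ) [n.AtLeastTwo],
      ((OfNat.ofNat n, OfNat.ofNat n) : RatFunc ℚ × ℚ) ∈ regularAt (0 : ℚ) :=
    fun n _ => natCast_mem (regularAt (0 : ℚ)) n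
  have hdiv {a a' : RatFunc ℚ} {b b' : ℚ} := @div_mem_regularAt ℚ _ 0 a a' b b'
  refine ⟨?_, ?_, ?_, ?_, ?_, ?_, ?_, ?_, ?_, ?_, ?_, ?_, ?_, ?_⟩ <;>
  simp only [a1, a2, a3, a4, a5, a6, a7, a8, a9, a10, a11, a12, a13, a14] <;>
  repeat' first
    | with_reducible exact hone
    | with_reducible exact X_mem_regularAt
    | with_reducible exact hnat _
    | with_reducible apply hadd
    | with_reducible apply hsub
    | with_reducible apply hmul
    | with_reducible apply hneg
    | with_reducible apply hpow
    | with_reducible refine hdiv ?_ ?_ (by norm_num)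

theorem f0_specializes : Specializes 0 (f0 (RatFunc.X : RatFunc ℚ)) (f0 (0 : ℚ)) := by
  obtain ⟨h1, h2, h3, h4, h5, h6, h7, h8, h9, h10, -⟩ := coeff_mem_regularAt_zero
  exact ((((((((((Specializes.X.pow 10).add ((Specializes.C h1).mul (Specializes.X.pow 9))).add
    ((Specializes.C h2).mul (Specializes.X.pow 8))).add
    ((Specializes.C h3).mul (Specializes.X.pow 7))).add
    ((Specializes.C h4).mul (Specializes.X.pow 6))).add
    ((Specializes.C h5).mul (Specializes.X.pow 5))).add
    ((Specializes.C h6).mul (Specializes.X.pow 4))).add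
    ((Specializes.C h7).mul (Specializes.X.pow 3))).add
    ((Specializes.C h8).mul (Specializes.X.pow 2))).add
    ((Specializes.C h9).mul Specializes.X)).add (Specializes.C h10)

theorem g0_specializes : Specializes 0 (g0 (RatFunc.X : RatFunc ℚ)) (g0 (0 : ℚ)) := by
  obtain ⟨-, -, -, -, -, -, -, -, -, -, h11, -⟩ := coeff_mem_regularAt_zero
  exact ((Specializes.X.pow 2).sub ((Specializes.ofNat 6).mul Specializes.X)).add
    (Specializes.C h11)

theorem g1_specializes : Specializes 0 (g1 (RatFunc.X : RatFunc ℚ)) (g1 (0 : ℚ)) := by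
  obtain ⟨-, -, -, -, -, -, -, -, -, -, -, h12, h13, h14⟩ := coeff_mem_regularAt_zero
  exact (((Specializes.X.pow 3).add ((Specializes.C h12).mul (Specializes.X.pow 2))).add
    ((Specializes.C h13).mul Specializes.X)).add (Specializes.C h14)

theorem f0_zero : f0 (0 : ℚ) = X^10 - 91*X^9 - 528*X^8 + 3076*X^7 - 1762*X^6 - 5802*X^5
    - 11012*X^4 - 11596*X^3 - 3543*X^2 + 141*X + 12 := by
  have h : ∀ (n : ℕ) [n.AtLeastTwo], (OfNat.ofNat n : ℚ[X]) = C (OfNat.ofNat n) := fun _ _ => rfl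
  simp only [f0, a1, a2, a3, a4, a5, a6, a7, a8, a9, a10, h]
  norm_num
  ring

theorem g0_zero : g0 (0 : ℚ) = X^2 - 6*X - 1 := by
  simp [g0, a11, sub_eq_add_neg]

theorem g1_zero : g1 (0 : ℚ) = (X + 2) * (X^2 - X - 1) := by
  have h : ∀ (n : ℕ) [n.AtLeastTwo], (OfNat.ofNat n : ℚ[X]) = C (OfNat.ofNat n) := fun _ _ => rfl
  have h12 : a12 (0 : ℚ) = 1 := by norm_num [a12]
  have h13 : a13 (0 : ℚ) = -3 := by norm_num [a13]
  have h14 : a14 (0 : ℚ) = -2 := by norm_num [a14]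
  rw [g1, h12, h13, h14, map_one, map_neg, map_neg, ← h 3, ← h 2]
  ring

theorem isCoprime_of_mul_add_mul_eq_C {k : Type*} [Field k] {p q u v : k[X]} {c : k}
    (hc : c ≠ 0) (h : u * p + v * q = C c) : IsCoprime p q := by
  refine ⟨C c⁻¹ * u, C c⁻¹ * v, ?_⟩
  rw [mul_assoc, mul_assoc, ← mul_add, h, ← C_mul, inv_mul_cancel₀ hc, C_1]

theorem isCoprime_f0_zero :
    IsCoprime (f0 (0 : ℚ)) (g0 0) ∧ IsCoprime (f0 (0 : ℚ)) (g1 0) ∧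
      IsCoprime (f0 (0 : ℚ)) X := by
  have h : ∀ (n : ℕ) [n.AtLeastTwo], (C (OfNat.ofNat n) : ℚ[X]) = OfNat.ofNat n := fun _ _ => rfl
  rw [f0_zero, g0_zero, g1_zero]
  refine ⟨?_, IsCoprime.mul_right ?_ ?_, ?_⟩
  · refine isCoprime_of_mul_add_mul_eq_C (c := 8100000) (by norm_num)
      (u := 20773*X - 128009)
      (v := -20773*X^9 + 1893714*X^8 + 10660836*X^7 - 65627770*X^6 + 47251926*X^5
        + 112856874*X^4 + 210437228*X^3 + 206728842*X^2 + 40016655*X - 9636108) ?_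
    rw [h]
    ring
  · refine isCoprime_of_mul_add_mul_eq_C (c := -506250) (by norm_num) (u := 1)
      (v := -X^9 + 93*X^8 + 342*X^7 - 3760*X^6 + 9282*X^5 - 12762*X^4 + 36536*X^3
        - 61476*X^2 + 126495*X - 253131) ?_
    rw [C_neg, h]
    ring
  · refine isCoprime_of_mul_add_mul_eq_C (c := -3125) (by norm_num) (u := 123*X - 199)
      (v := -123*X^9 + 11269*X^8 + 57981*X^7 - 414170*X^6 + 472661*X^5 + 421499*X^4
        + 1094038*X^3 + 750457*X^2 - 27320*X + 737) ?_
    rw [C_neg, h]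
    ring
  · refine isCoprime_of_mul_add_mul_eq_C (c := 12) (by norm_num) (u := 1)
      (v := -X^9 + 91*X^8 + 528*X^7 - 3076*X^6 + 1762*X^5 + 5802*X^4 + 11012*X^3
        + 11596*X^2 + 3543*X - 141) ?_
    rw [h]
    ring

theorem isCoprime_X_sub_three_zero :
    IsCoprime (X - 3 : ℚ[X]) (g0 0) ∧ IsCoprime (X - 3 : ℚ[X]) (g1 0) ∧
      IsCoprime (X - 3 : ℚ[X]) X := by
  have h : ∀ (n : ℕ) [n.AtLeastTwo], (C (OfNat.ofNat n) : ℚ[X]) = OfNat.ofNat n := fun _ _ => rfl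
  rw [g0_zero, g1_zero]
  refine ⟨?_, IsCoprime.mul_right ?_ ?_, ?_⟩
  · refine isCoprime_of_mul_add_mul_eq_C (c := 10) (by norm_num) (u := X - 3) (v := -1) ?_
    rw [h]
    ring
  · refine isCoprime_of_mul_add_mul_eq_C (c := 5) (by norm_num) (u := -1) (v := 1) ?_
    rw [h]
    ring
  · refine isCoprime_of_mul_add_mul_eq_C (c := 5) (by norm_num) (u := -X - 2) (v := 1) ?_
    rw [h]
    ring
  · refine isCoprime_of_mul_add_mul_eq_C (c := 3) (by norm_num) (u := -1) (v := 1) ?_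
    rw [h]
    ring

theorem isCoprime_numer_denom_zero : IsCoprime (numer (0 : ℚ)) (denom 0) := by
  obtain ⟨h1, h2, h3⟩ := isCoprime_f0_zero
  obtain ⟨h4, h5, h6⟩ := isCoprime_X_sub_three_zero
  exact IsCoprime.mul_left
    (IsCoprime.pow_left (IsCoprime.mul_right (h1.pow_right.mul_right h2.pow_right) h3))
    (IsCoprime.mul_right (h4.pow_right.mul_right h5.pow_right) h6)

theorem isCoprime_numer_denom :
    IsCoprime (numer (RatFunc.X : RatFunc ℚ)) (denom RatFunc.X) := by
  refine Specializes.isCoprime (c := 0) ?_ ?_ (numer_monic _) (denom_monic _)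
    (numer_monic 0) (denom_monic 0) (by simp only [numer_natDegree])
    (by simp only [denom_natDegree]) isCoprime_numer_denom_zero
  · exact (f0_specializes.pow 3).mul (Specializes.X.sub (Specializes.ofNat 3))
  · exact ((g0_specializes.pow 8).mul (g1_specializes.pow 4)).mul Specializes.X

/-- If `p` is monic and coprime to `q` and `deg q < deg p`, then `p - t q` is irreducible over
`K(t)`. -/
theorem irreducible_map_sub_X_mul_map {K : Type*} [Field K] {p q : K[X]} (hp : p.Monic)
    (hq : q ≠ 0) (hdeg : q.degree < p.degree) (h : IsCoprime p q) :
    Irreducible (p.map (RatFunc.C (K := K)) - C RatFunc.X * q.map (RatFunc.C (K := K))) := by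
  have hmonic : (p.map (C : K →+* K[X]) - C X * q.map (C : K →+* K[X])).Monic := by
    refine (hp.map C).sub_of_left ?_
    rwa [degree_C_mul X_ne_zero, degree_map_eq_of_injective C_injective,
      degree_map_eq_of_injective C_injective]
  have hirr : Irreducible (p.map (C : K →+* K[X]) - C X * q.map (C : K →+* K[X])) := by
    rw [← MulEquiv.irreducible_iff (Bivariate.swap (R := K))]
    have hlin := irreducible_C_mul_X_add_C (neg_ne_zero.2 hq) h.symm.neg_left.isRelPrime
    convert hlin using 1
    rw [map_sub, map_mul, Bivariate.swap_map_C, Bivariate.swap_map_C, Bivariate.swap_X, C_neg]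
    ring
  rw [hmonic.irreducible_iff_irreducible_map_fraction_map (K := RatFunc K)] at hirr
  convert hirr using 1
  rw [Polynomial.map_sub, Polynomial.map_mul, Polynomial.map_map, Polynomial.map_map, map_C,
    RatFunc.algebraMap_X]
  rfl

/-- The polynomial `f(x, α, t)`, of degree 31 in `x`, is irreducible over
`ℚ(α, t)`. -/
theorem fFamily_irreducible :
    (fFamily (RatFunc.C RatFunc.X : RatFunc (RatFunc ℚ)) RatFunc.X).natDegree = 31 ∧
    Irreducible (fFamily (RatFunc.C RatFunc.X : RatFunc (RatFunc ℚ)) RatFunc.X) := by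
  rw [fFamily_eq, ← numer_map, ← denom_map]
  have hdeg : (denom (RatFunc.X : RatFunc ℚ)).degree <
      (numer (RatFunc.X : RatFunc ℚ)).degree := by
    refine degree_lt_degree ?_
    rw [numer_natDegree, denom_natDegree]
    norm_num
  refine ⟨?_, irreducible_map_sub_X_mul_map (numer_monic _) (denom_monic _).ne_zero hdeg
    isCoprime_numer_denom⟩
  rw [natDegree_sub_eq_left_of_natDegree_lt, natDegree_map, numer_natDegree]
  rw [natDegree_C_mul RatFunc.X_ne_zero, natDegree_map, natDegree_map, numer_natDegree,
    denom_natDegree]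
  norm_num

end PSL52Family
end

section
/- Set f̃(x, t) := (x⁵ − 95x⁴ − 110x³ − 150x² − 75x − 3)³·(x⁵ + 4x⁴ − 38x³ + 56x² + 53x − 4)³·(x − 3) − t·(x² − 6x − 1)⁸·(x² − x − 1)⁴·(x + 2)⁴·x, a polynomial of degree 31 in x over the rational function field ℚ(t). Then the Galois group of f̃ over ℚ(t) is isomorphic to PSL₅(𝔽₂), the projective special linear group of degree 5 over the field with two elements. -/
/-!
Statement 2: the specialized polynomial
`f̃(x, t) = (x⁵ − 95x⁴ − 110x³ − 150x² − 75x − 3)³·(x⁵ + 4x⁴ − 38x³ + 56x² + 53x − 4)³·(x − 3)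
  − t·(x² − 6x − 1)⁸·(x² − x − 1)⁴·(x + 2)⁴·x`,
of degree 31 in `x`, has Galois group `PSL₅(𝔽₂)` over `ℚ(t)`.
We model `ℚ(t)` as `RatFunc ℚ`, with `t = RatFunc.X` a transcendental over `ℚ`.
-/

open Polynomial

namespace PSL52Family

/-- The polynomial `f̃(x, t)` over `ℚ(t)`, obtained from the paper's family by the
specialization `α ↦ 0`. -/
noncomputable def fTilde : Polynomial (RatFunc ℚ) :=
  (X^5 - 95*X^4 - 110*X^3 - 150*X^2 - 75*X - 3)^3 *
    (X^5 + 4*X^4 - 38*X^3 + 56*X^2 + 53*X - 4)^3 * (X - 3)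
  - C RatFunc.X * (X^2 - 6*X - 1)^8 * (X^2 - X - 1)^4 * (X + 2)^4 * X

universe uE

section Transvections

open Matrix

/-- A square matrix of size five over `𝔽₂` with at least 15 nonzero fixed vectors is the identity
or differs from it by a matrix of rank one. -/
theorem exists_eq_one_add_vecMulVec (N : Matrix (Fin 5) (Fin 5) (ZMod 2)) (hN : N ≠ 1)
    (hinj : Function.Injective N.mulVec)
    (hfix : 15 ≤ Nat.card {v : Fin 5 → ZMod 2 // v ≠ 0 ∧ N *ᵥ v = v}) :
    ∃ w φ : Fin 5 → ZMod 2, w ≠ 0 ∧ φ ≠ 0 ∧ φ ⬝ᵥ w = 0 ∧ N = 1 + vecMulVec w φ := by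
  classical
  let W : AddSubgroup (Fin 5 → ZMod 2) := (N - 1).mulVecLin.toAddMonoidHom.ker
  have hW (v) : v ∈ W ↔ N *ᵥ v = v := by
    simp [W, AddMonoidHom.mem_ker, sub_eq_zero]
  have hcard : 16 ≤ Nat.card W := by
    have e : {v : Fin 5 → ZMod 2 // v ≠ 0 ∧ N *ᵥ v = v} ≃ {v : W // v ≠ 0} :=
      { toFun v := ⟨⟨v.1, (hW _).2 v.2.2⟩, fun h ↦ v.2.1 (congrArg Subtype.val h)⟩
        invFun v := ⟨v.1.1, fun h ↦ v.2 (Subtype.ext h), (hW _).1 v.1.2⟩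
        left_inv _ := rfl
        right_inv _ := rfl }
    rw [Nat.card_congr e, Nat.card_eq_fintype_card, Fintype.card_subtype_compl,
      Fintype.card_subtype_eq] at hfix
    rw [Nat.card_eq_fintype_card]
    omega
  have htop : W ≠ ⊤ := by
    intro h
    apply hN
    apply ext_of_mulVec_single
    intro i
    rw [one_mulVec]
    exact (hW _).1 (h ▸ AddSubgroup.mem_top _)
  have hindex : W.index = 2 := by
    have h1 := W.card_mul_index
    have h2 : Nat.card (Fin 5 → ZMod 2) = 32 := by simp
    have h3 : W.index ≠ 1 := fun h ↦ htop (AddSubgroup.index_eq_one.1 h)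
    have h4 : W.index ≠ 0 := AddSubgroup.index_ne_zero_of_finite
    have h5 : W.index < 3 := by
      by_contra! h
      nlinarith
    omega
  obtain ⟨a, ha⟩ : ∃ a, a ∉ W := by
    by_contra! h
    exact htop (AddSubgroup.eq_top_iff' W |>.2 h)
  let w := (N - 1) *ᵥ a
  have hw : w ≠ 0 := by
    intro h
    apply ha
    rw [hW]
    simpa [w, sub_mulVec, sub_eq_zero] using h
  have hval (v) : (N - 1) *ᵥ v = if v ∈ W then 0 else w := by
    split_ifs with h
    · rw [sub_mulVec, (hW v).1 h]; simp
    · have hs : v - a ∈ W := by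
        rw [sub_eq_add_neg, AddSubgroup.add_mem_iff_of_index_two hindex, neg_mem_iff]
        tauto
      have : (N - 1) *ᵥ (v - a) = 0 := by rw [sub_mulVec, (hW _).1 hs]; simp
      rw [mulVec_sub, sub_eq_zero] at this
      exact this
  let φ : Fin 5 → ZMod 2 := fun j ↦ if Pi.single j 1 ∈ W then 0 else 1
  have hNφ : N = 1 + vecMulVec w φ := by
    rw [← sub_eq_iff_eq_add']
    apply ext_of_mulVec_single
    intro j
    rw [hval, vecMulVec_mulVec, dotProduct_single_one]
    simp only [φ]
    split_ifs <;> simp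
  refine ⟨w, φ, hw, ?_, ?_, hNφ⟩
  · rintro h
    apply hN
    rw [hNφ, h]
    ext i j
    simp
  · by_contra h
    have h1 : φ ⬝ᵥ w = 1 := by
      revert h
      generalize φ ⬝ᵥ w = c
      revert c
      decide
    have h2 : N *ᵥ w = 0 := by
      rw [hNφ, add_mulVec, one_mulVec, vecMulVec_mulVec, h1]
      ext i
      simp [CharTwo.add_self_eq_zero]
    exact hw (hinj (by simpa using h2))

/-- Over `𝔽₂` the matrices of determinant one are products of transvections. -/
theorem eq_prod_transvections (M : Matrix (Fin 5) (Fin 5) (ZMod 2)) (hM : M.det = 1) :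
    ∃ L : List (TransvectionStruct (Fin 5) (ZMod 2)),
      M = (L.map TransvectionStruct.toMatrix).prod := by
  obtain ⟨L, L', D, h⟩ := Pivot.exists_list_transvec_mul_diagonal_mul_list_transvec M
  have hD : D = 1 := by
    have h1 := congrArg det h
    rw [det_mul, det_mul, TransvectionStruct.det_toMatrix_prod,
      TransvectionStruct.det_toMatrix_prod,
      hM, det_diagonal, one_mul, mul_one] at h1
    funext i
    have h2 : D i ≠ 0 := fun h0 ↦ by
      rw [Finset.prod_eq_zero (Finset.mem_univ i) h0] at h1
      exact one_ne_zero h1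
    revert h2
    simp only [Pi.one_apply]
    generalize D i = c
    revert c
    decide
  refine ⟨L ++ L', ?_⟩
  rw [h, hD, List.map_append, List.prod_append]
  simp

end Transvections

section Action

open Matrix

/-- The space `𝔽₂⁵`. -/
abbrev V := Fin 5 → ZMod 2

variable {H X Y : Type*} [Group H] [MulAction H X] [MulAction H Y]

/-- Transport an action along a labelling by nonzero vectors, fixing zero. -/
noncomputable def act (e : {v : V // v ≠ 0} ≃ X) (σ : H) (v : V) : V :=
  open Classical in if h : v = 0 then 0 else e.symm (σ • e ⟨v, h⟩)

theorem act_zero (e : {v : V // v ≠ 0} ≃ X) (σ : H) : act e σ 0 = 0 := by simp [act]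

theorem act_coe (e : {v : V // v ≠ 0} ≃ X) (σ : H) (v : {v : V // v ≠ 0}) :
    act e σ v = e.symm (σ • e v) := by
  simp [act, v.2]

theorem act_ne_zero (e : {v : V // v ≠ 0} ≃ X) (σ : H) {v : V} (h : v ≠ 0) : act e σ v ≠ 0 := by
  rw [act_coe e σ ⟨v, h⟩]
  exact (e.symm _).2

theorem act_one (e : {v : V // v ≠ 0} ≃ X) (v : V) : act e (1 : H) v = v := by
  by_cases h : v = 0 <;> simp [act, h]

theorem act_mul (e : {v : V // v ≠ 0} ≃ X) (σ τ : H) (v : V) :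
    act e (σ * τ) v = act e σ (act e τ v) := by
  by_cases h : v = 0
  · simp [h, act_zero]
  · lift v to {v : V // v ≠ 0} using h
    rw [act_coe, act_coe, act_coe, mul_smul, Equiv.apply_symm_apply]

variable {eX : {v : V // v ≠ 0} ≃ X} {eY : {v : V // v ≠ 0} ≃ Y} {I : X → Y → Prop}

/-- The labellings of `X` and `Y` turn the relation `I` into the orthogonality relation, and the
group preserves `I`. -/
structure IsProjectiveLabelling (H : Type*) [Group H] [MulAction H X] [MulAction H Y]
    (eX : {v : V // v ≠ 0} ≃ X) (eY : {v : V // v ≠ 0} ≃ Y) (I : X → Y → Prop) : Prop where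
  smul_iff : ∀ (σ : H) x y, I (σ • x) (σ • y) ↔ I x y
  iff_dotProduct : ∀ v φ, I (eX v) (eY φ) ↔ φ.1 ⬝ᵥ v.1 = 0

namespace IsProjectiveLabelling

variable (h : IsProjectiveLabelling H eX eY I)

include h

theorem dotProduct_act (σ : H) (v φ : V) : act eY σ φ ⬝ᵥ act eX σ v = φ ⬝ᵥ v := by
  have key : ∀ a b : ZMod 2, (a = 0 ↔ b = 0) → a = b := by decide
  apply key
  by_cases hv : v = 0
  · simp [hv, act_zero]
  by_cases hφ : φ = 0
  · simp [hφ, act_zero]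
  lift v to {v : V // v ≠ 0} using hv
  lift φ to {v : V // v ≠ 0} using hφ
  rw [act_coe, act_coe, ← h.iff_dotProduct, ← h.iff_dotProduct, Equiv.apply_symm_apply,
    Equiv.apply_symm_apply, h.smul_iff]

theorem dotProduct_act_right (σ : H) (v φ : V) : φ ⬝ᵥ act eX σ v = act eY σ⁻¹ φ ⬝ᵥ v := by
  rw [← h.dotProduct_act σ v, ← act_mul, mul_inv_cancel, act_one]

end IsProjectiveLabelling

/-- The matrix of the action of a group element on `𝔽₂⁵`. -/
noncomputable def actMatrix (eY : {v : V // v ≠ 0} ≃ Y) (σ : H) : Matrix (Fin 5) (Fin 5) (ZMod 2) :=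
  Matrix.of fun i ↦ act eY σ⁻¹ (Pi.single i 1)

namespace IsProjectiveLabelling

variable (h : IsProjectiveLabelling H eX eY I)

include h

theorem actMatrix_mulVec (σ : H) (v : V) : actMatrix eY σ *ᵥ v = act eX σ v := by
  funext i
  change act eY σ⁻¹ (Pi.single i 1) ⬝ᵥ v = _
  rw [← h.dotProduct_act_right, single_one_dotProduct]

theorem vecMul_actMatrix (σ : H) (φ : V) : φ ᵥ* actMatrix eY σ = act eY σ⁻¹ φ := by
  funext i
  rw [← dotProduct_single_one (φ ᵥ* actMatrix eY σ), ← dotProduct_mulVec, h.actMatrix_mulVec,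
    h.dotProduct_act_right, dotProduct_single_one]

theorem actMatrix_one : actMatrix eY (1 : H) = 1 := by
  apply ext_of_mulVec_single
  intro i
  rw [h.actMatrix_mulVec, act_one, one_mulVec]

theorem actMatrix_mul (σ τ : H) : actMatrix eY (σ * τ) = actMatrix eY σ * actMatrix eY τ := by
  apply ext_of_mulVec_single
  intro i
  rw [h.actMatrix_mulVec, act_mul, ← mulVec_mulVec, h.actMatrix_mulVec, h.actMatrix_mulVec]

theorem det_actMatrix (σ : H) : (actMatrix eY σ).det = 1 := by
  have h1 : (actMatrix eY σ).det * (actMatrix eY σ⁻¹).det = 1 := by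
    rw [← det_mul, ← h.actMatrix_mul, mul_inv_cancel, h.actMatrix_one, det_one]
  revert h1
  generalize (actMatrix eY σ).det = a
  generalize (actMatrix eY σ⁻¹).det = b
  revert a b
  decide

/-- The linear representation attached to a projective labelling. -/
noncomputable def toSL : H →* SpecialLinearGroup (Fin 5) (ZMod 2) where
  toFun σ := ⟨actMatrix eY σ, h.det_actMatrix σ⟩
  map_one' := Subtype.ext h.actMatrix_one
  map_mul' σ τ := Subtype.ext (h.actMatrix_mul σ τ)

theorem actMatrix_eq_one_iff (σ : H) : actMatrix eY σ = 1 ↔ ∀ x : X, σ • x = x := by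
  constructor
  · intro h1 x
    have h2 := h.actMatrix_mulVec σ (eX.symm x)
    rw [h1, one_mulVec, act_coe, Equiv.apply_symm_apply] at h2
    exact (eX.symm.injective (Subtype.ext h2)).symm
  · intro h1
    apply ext_of_mulVec_single
    intro i
    rw [h.actMatrix_mulVec, one_mulVec]
    by_cases h0 : (Pi.single i 1 : V) = 0
    · rw [h0, act_zero]
    · rw [act_coe eX σ ⟨_, h0⟩, h1, Equiv.symm_apply_apply]

theorem toSL_eq_one_iff (σ : H) : h.toSL σ = 1 ↔ ∀ x : X, σ • x = x := by
  rw [← h.actMatrix_eq_one_iff]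
  exact Subtype.ext_iff

theorem act_dual_of_trivial (σ : H) (h1 : ∀ x : X, σ • x = x) (φ : V) : act eY σ φ = φ := by
  have h2 := h.vecMul_actMatrix σ⁻¹ φ
  rw [(h.actMatrix_eq_one_iff _).2 fun x ↦ by rw [inv_smul_eq_iff, h1], vecMul_one, inv_inv] at h2
  exact h2.symm

/-- Conjugating a rank one perturbation of the identity. -/
theorem conj_one_add_vecMulVec (σ τ : H) (v φ : V) (hτ : actMatrix eY τ = 1 + vecMulVec v φ) :
    actMatrix eY (σ * τ * σ⁻¹) = 1 + vecMulVec (act eX σ v) (act eY σ φ) := by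
  rw [h.actMatrix_mul, h.actMatrix_mul, hτ, mul_add, add_mul, mul_one, ← h.actMatrix_mul,
    mul_inv_cancel, h.actMatrix_one, mul_vecMulVec, vecMulVec_mul, h.actMatrix_mulVec,
    h.vecMul_actMatrix, inv_inv]

/-- The functionals `φ` vanishing at `v` for which the transvection `1 + v φᵀ` is realised. -/
def axes (v : V) : AddSubgroup V where
  carrier := {φ | φ ⬝ᵥ v = 0 ∧ ∃ τ : H, actMatrix eY τ = 1 + vecMulVec v φ}
  zero_mem' := ⟨by simp, 1, by
    rw [h.actMatrix_one]
    ext i j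
    simp⟩
  add_mem' := by
    rintro φ ψ ⟨h1, σ, hσ⟩ ⟨h2, τ, hτ⟩
    refine ⟨by rw [add_dotProduct, h1, h2, add_zero], σ * τ, ?_⟩
    rw [h.actMatrix_mul, hσ, hτ, mul_add, add_mul, add_mul, vecMulVec_mul_vecMulVec, h1,
      vecMulVec_add]
    simp [add_assoc]
  neg_mem' := by
    rintro φ hφ
    rwa [ZModModule.neg_eq_self]

theorem mem_axes {v φ : V} :
    φ ∈ h.axes v ↔ φ ⬝ᵥ v = 0 ∧ ∃ τ : H, actMatrix eY τ = 1 + vecMulVec v φ := Iff.rfl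

theorem act_mem_axes (σ : H) {v φ : V} (hφ : φ ∈ h.axes v) :
    act eY σ φ ∈ h.axes (act eX σ v) := by
  obtain ⟨h1, τ, hτ⟩ := h.mem_axes.1 hφ
  exact h.mem_axes.2 ⟨by rw [h.dotProduct_act, h1], _, h.conj_one_add_vecMulVec σ τ v φ hτ⟩

theorem mem_axes_of_order_five {v : V} (hv : v ≠ 0) (hne : ∃ φ ∈ h.axes v, φ ≠ 0) (u : H)
    (hu : act eX u v = v) (hu5 : ∀ x : X, u ^ 5 • x = x)
    (hfree : ∀ φ : V, φ ≠ 0 → φ ⬝ᵥ v = 0 → act eY u φ ≠ φ) {φ : V} (hφ : φ ⬝ᵥ v = 0) :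
    φ ∈ h.axes v := by
  classical
  have : Fact (Nat.Prime 5) := ⟨by norm_num⟩
  let f : Function.End (h.axes v) := fun φ ↦
    ⟨act eY u φ.1, by simpa only [hu] using h.act_mem_axes u φ.2⟩
  have hf (n : ℕ) (φ : h.axes v) : ((f ^ n) φ).1 = act eY (u ^ n) φ.1 := by
    induction n generalizing φ with
    | zero =>
      rw [pow_zero, pow_zero, act_one]
      rfl
    | succ n ih =>
      rw [pow_succ, pow_succ, act_mul]
      exact ih (f φ)
  have hf5 : f ^ 5 ^ 1 = 1 := by
    funext φ
    apply Subtype.ext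
    rw [pow_one, hf]
    exact h.act_dual_of_trivial _ hu5 _
  have hmod := Equiv.Perm.card_fixedPoints_modEq hf5
  have hfp : Function.fixedPoints f = {0} := by
    ext φ
    simp only [Set.mem_singleton_iff]
    constructor
    · intro h1
      by_contra h2
      exact hfree φ.1 (fun h3 ↦ h2 (Subtype.ext h3)) (h.mem_axes.1 φ.2).1 (congrArg Subtype.val h1)
    · rintro rfl
      exact Subtype.ext (act_zero eY u)
  have hfp' : Fintype.card (Function.fixedPoints f) = 1 := by
    rw [← Nat.card_eq_fintype_card, hfp]
    simp
  rw [hfp', ← Nat.card_eq_fintype_card] at hmod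
  have hV : Nat.card V = 2 ^ 5 := by simp
  let P : AddSubgroup V :=
    { carrier := {φ | φ ⬝ᵥ v = 0}
      zero_mem' := by simp
      add_mem' := by
        intro a b ha hb
        simp only [Set.mem_ofPred_eq] at *
        rw [add_dotProduct, ha, hb, add_zero]
      neg_mem' := by simp }
  have hle : h.axes v ≤ P := fun φ hφ ↦ (h.mem_axes.1 hφ).1
  have hP : Nat.card P ≤ 16 := by
    obtain ⟨k, hk, hk'⟩ := (Nat.dvd_prime_pow Nat.prime_two).1 (hV ▸ P.card_addSubgroup_dvd_card)
    have : Nat.card P ≠ 32 := by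
      intro h1
      have h2 : P = ⊤ := P.eq_top_of_card_eq (by rw [h1, hV]; norm_num)
      apply hv
      funext i
      have : Pi.single i 1 ∈ P := h2 ▸ AddSubgroup.mem_top _
      simpa [P] using this
    interval_cases k <;> omega
  have hge : 16 ≤ Nat.card (h.axes v) := by
    obtain ⟨k, hk, hk'⟩ := (Nat.dvd_prime_pow Nat.prime_two).1
      (hV ▸ (h.axes v).card_addSubgroup_dvd_card)
    have : Nat.card (h.axes v) ≠ 1 := by
      intro h1
      obtain ⟨φ, hφ, hφ0⟩ := hne
      rw [AddSubgroup.card_eq_one] at h1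
      rw [h1, AddSubgroup.mem_bot] at hφ
      exact hφ0 hφ
    rw [hk'] at hmod this ⊢
    interval_cases k <;> revert hmod <;> revert this <;> decide
  have : h.axes v = P := AddSubgroup.eq_of_le_of_card_ge hle (hP.trans hge)
  rw [this]
  exact hφ

/-- A group preserving the projective labelling, transitive on points, containing a transvection
and an element of order five which fixes a point but no hyperplane through it, induces the whole
special linear group. -/
theorem toSL_surjective [MulAction.IsPretransitive H X]
    (τ : H) (hτ : 15 ≤ Nat.card {x : X // τ • x = x}) (hτ1 : ∃ x : X, τ • x ≠ x)
    (u : H) (x₀ : X) (hu : u • x₀ = x₀) (hu5 : ∀ x : X, u ^ 5 • x = x)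
    (hfree : ∀ y, I x₀ y → u • y ≠ y) : Function.Surjective h.toSL := by
  have htrans {v w : V} (hv : v ≠ 0) (hw : w ≠ 0) : ∃ σ : H, act eX σ v = w := by
    obtain ⟨σ, hσ⟩ := MulAction.exists_smul_eq H (eX ⟨v, hv⟩) (eX ⟨w, hw⟩)
    exact ⟨σ, by rw [act_coe eX σ ⟨v, hv⟩, hσ, Equiv.symm_apply_apply]⟩
  obtain ⟨w, ψ, hw, hψ, hψw, hN⟩ := exists_eq_one_add_vecMulVec (actMatrix eY τ)
    (by
      rw [Ne, h.actMatrix_eq_one_iff]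
      simpa using hτ1)
    (by
      intro a b hab
      have := congrArg (act eX τ⁻¹) (a₁ := act eX τ a) (a₂ := act eX τ b)
        (by simpa only [h.actMatrix_mulVec] using hab)
      rwa [← act_mul, ← act_mul, inv_mul_cancel, act_one, act_one] at this)
    (by
      refine hτ.trans (Nat.card_le_card_of_injective
        (fun x ↦ ⟨eX.symm x.1, (eX.symm x.1).2, ?_⟩) ?_)
      · rw [h.actMatrix_mulVec, act_coe, Equiv.apply_symm_apply, x.2]
      · intro x y hxy
        have hxy' := Subtype.ext_iff.1 hxy
        exact Subtype.ext (eX.symm.injective (Subtype.ext hxy')))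
  set v₀ := eX.symm x₀ with hv₀
  have hall {v φ : V} (hv : v ≠ 0) (hφ : φ ⬝ᵥ v = 0) : φ ∈ h.axes v := by
    obtain ⟨ρ, hρ⟩ := htrans hw v₀.2
    obtain ⟨σ, hσ⟩ := htrans v₀.2 hv
    have h1 : act eY σ⁻¹ φ ∈ h.axes v₀.1 := by
      refine h.mem_axes_of_order_five v₀.2 ⟨_, ?_, act_ne_zero eY ρ hψ⟩ u ?_ hu5 ?_ ?_
      · exact hρ ▸ h.act_mem_axes ρ (h.mem_axes.2 ⟨hψw, τ, hN⟩)
      · rw [act_coe, hv₀, Equiv.apply_symm_apply, hu]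
      · intro φ hφ hφv hφu
        refine hfree (eY ⟨φ, hφ⟩) ?_ ?_
        · have := (h.iff_dotProduct v₀ ⟨φ, hφ⟩).2 hφv
          rwa [hv₀, Equiv.apply_symm_apply] at this
        · rw [act_coe eY u ⟨φ, hφ⟩] at hφu
          rw [← Equiv.symm_apply_eq]
          exact Subtype.ext hφu
      · rw [← h.dotProduct_act_right, hσ, hφ]
    have h2 := h.act_mem_axes σ h1
    rwa [hσ, ← act_mul, mul_inv_cancel, act_one] at h2
  intro M
  obtain ⟨L, hL⟩ := eq_prod_transvections M.1 M.2
  suffices ∀ L : List (TransvectionStruct (Fin 5) (ZMod 2)),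
      ∃ σ : H, actMatrix eY σ = (L.map TransvectionStruct.toMatrix).prod by
    obtain ⟨σ, hσ⟩ := this L
    exact ⟨σ, Subtype.ext (hσ.trans hL.symm)⟩
  intro L
  induction L with
  | nil => exact ⟨1, h.actMatrix_one⟩
  | cons t L ih =>
    obtain ⟨σ, hσ⟩ := ih
    obtain ⟨-, ρ, hρ⟩ := h.mem_axes.1 (hall (v := Pi.single t.i 1) (φ := Pi.single t.j t.c)
      (by simp) (by simp [t.hij.symm]))
    refine ⟨ρ * σ, ?_⟩
    rw [h.actMatrix_mul, hρ, hσ, List.map_cons, List.prod_cons]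
    congr 1
    rw [TransvectionStruct.toMatrix, transvection]
    congr 1
    ext i j
    simp [vecMulVec_apply, single_apply, Pi.single_apply]
    grind

end IsProjectiveLabelling

end Action

section Places

/-- Reduction of the ring of integers of a finite Galois extension modulo a prime above the kernel
of a homomorphism to a prime field, together with a Frobenius element. -/
theorem exists_reduction_and_frobenius {A K : Type*} {E : Type uE} [CommRing A] [IsDomain A]
    [IsIntegrallyClosed A] [IsNoetherianRing A] [Field K] [Algebra A K] [IsFractionRing A K]
    [Field E] [Algebra K E] [Algebra A E] [IsScalarTower A K E] [FiniteDimensional K E]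
    [IsGalois K E] {p : ℕ} [Fact p.Prime] (ψ : A →+* ZMod p) :
    ∃ (k : Type uE) (_ : Field k) (_ : Algebra (ZMod p) k) (r : integralClosure A E →+* k)
      (u : E ≃ₐ[K] E), (∀ a, r (algebraMap A _ a) = algebraMap (ZMod p) k (ψ a)) ∧
        ∀ s, r (u • s) = r s ^ p := by
  let S := integralClosure A E
  have hψ : Function.Surjective ψ := ZMod.ringHom_surjective ψ
  have : (RingHom.ker ψ).IsMaximal := RingHom.ker_isMaximal_of_surjective ψ hψ
  have hinj : Function.Injective (algebraMap A S) := by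
    have h1 : Function.Injective (algebraMap A E) := by
      rw [IsScalarTower.algebraMap_eq A K E]
      exact (algebraMap K E).injective.comp (IsFractionRing.injective A K)
    exact fun a b hab ↦ h1 (congrArg Subtype.val hab)
  obtain ⟨Q, hQ, hQA⟩ := Ideal.exists_ideal_over_maximal_of_isIntegral (S := S) (RingHom.ker ψ)
    (by rw [(RingHom.injective_iff_ker_eq_bot _).1 hinj]; exact bot_le)
  have hmem (a : A) : algebraMap A S a ∈ Q ↔ ψ a = 0 := by
    rw [← Ideal.mem_comap, hQA, RingHom.mem_ker]
  have hinv : Algebra.IsInvariant A S (E ≃ₐ[K] E) := by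
    refine ⟨fun b hb ↦ ?_⟩
    have hb' := (IsGalois.mem_range_algebraMap_iff_fixed (F := K) (b : E)).2
      fun g ↦ congrArg Subtype.val (hb g)
    obtain ⟨x, hx⟩ := hb'
    have h2 : IsIntegral A x := by
      rw [← isIntegral_algebraMap_iff (algebraMap K E).injective, hx]
      exact b.2
    obtain ⟨a, rfl⟩ := IsIntegrallyClosed.algebraMap_eq_of_integral h2
    exact ⟨a, Subtype.ext ((IsScalarTower.algebraMap_apply A K E a).trans hx)⟩
  have hQu : Q.under A = RingHom.ker ψ := hQA
  have hcard : Nat.card (A ⧸ Q.under A) = p := by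
    rw [hQu, Nat.card_congr (RingHom.quotientKerEquivOfSurjective hψ).toEquiv, Nat.card_zmod]
  have hfinA : Finite (A ⧸ Q.under A) :=
    Nat.finite_of_card_ne_zero (hcard ▸ (Fact.out : p.Prime).ne_zero)
  have : Module.Finite A S := IsIntegralClosure.finite A K E S
  have hfin : Finite (S ⧸ Q) := by
    have : Module.Finite A (S ⧸ Q) := inferInstance
    have : Module.Finite (A ⧸ Q.under A) (S ⧸ Q) := Module.Finite.of_restrictScalars_finite A _ _
    exact Module.finite_of_finite (A ⧸ Q.under A)
  obtain ⟨u, hu⟩ := IsArithFrobAt.exists_of_isInvariant A (E ≃ₐ[K] E) Q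
  let : Field (S ⧸ Q) := Ideal.Quotient.field Q
  have hp : ((p : ℕ) : S ⧸ Q) = 0 := by
    have : algebraMap A S (p : A) ∈ Q := by rw [hmem, map_natCast, ZMod.natCast_self]
    rwa [map_natCast, ← Ideal.Quotient.eq_zero_iff_mem, map_natCast] at this
  have hchar : CharP (S ⧸ Q) p := (CharP.charP_iff_prime_eq_zero Fact.out).2 hp
  let : Algebra (ZMod p) (S ⧸ Q) := ZMod.algebra _ p
  refine ⟨S ⧸ Q, inferInstance, inferInstance, Ideal.Quotient.mk Q, u, fun a ↦ ?_, fun s ↦ ?_⟩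
  · have h1 : algebraMap A S (a - ((ψ a).val : A)) ∈ Q := by
      rw [hmem, map_sub, map_natCast, ZMod.natCast_zmod_val, sub_self]
    rw [map_sub, map_natCast, ← Ideal.Quotient.mk_eq_mk_iff_sub_mem, map_natCast] at h1
    rw [h1, ← map_natCast (algebraMap (ZMod p) (S ⧸ Q)), ZMod.natCast_zmod_val]
  · rw [← map_pow, Ideal.Quotient.eq]
    have := hu s
    rwa [hcard] at this

end Places

section CoefficientLists

/-- Evaluation of the polynomial with the given list of coefficients, constant term first. -/
def ev {R : Type*} [CommRing R] (l : List ℤ) (x : R) : R :=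
  l.foldr (fun (c : ℤ) s ↦ (c : R) + x * s) 0

/-- Evaluation of a bivariate polynomial, given as a polynomial in the second variable. -/
def ev₂ {R : Type*} [CommRing R] (L : List (List ℤ)) (x y : R) : R :=
  L.foldr (fun l s ↦ ev l x + y * s) 0

/-- Sum of coefficient lists. -/
def addL : List ℤ → List ℤ → List ℤ
  | [], m => m
  | a :: l, [] => a :: l
  | a :: l, b :: m => (a + b) :: addL l m

/-- Multiple of a coefficient list. -/
def smulL (c : ℤ) (l : List ℤ) : List ℤ := l.map (c * ·)

/-- Product of coefficient lists. -/
def mulL : List ℤ → List ℤ → List ℤ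
  | [], _ => []
  | a :: l, m => addL (smulL a m) (0 :: mulL l m)

/-- Sum of bivariate coefficient lists. -/
def addL₂ : List (List ℤ) → List (List ℤ) → List (List ℤ)
  | [], M => M
  | a :: L, [] => a :: L
  | a :: L, b :: M => addL a b :: addL₂ L M

/-- Product of bivariate coefficient lists. -/
def mulL₂ : List (List ℤ) → List (List ℤ) → List (List ℤ)
  | [], _ => []
  | a :: L, M => addL₂ (M.map (mulL a)) ([] :: mulL₂ L M)

/-- All coefficients are divisible by `p`. -/
def zeroMod (p : ℕ) (l : List ℤ) : Bool := l.all (fun c ↦ c % p == 0)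

/-- Coefficient list of the derivative of `x ^ n` times a polynomial, divided by `x ^ (n - 1)`. -/
def derivAux : ℕ → List ℤ → List ℤ
  | _, [] => []
  | n, a :: l => (n * a) :: derivAux (n + 1) l

variable {R : Type*} [CommRing R] (x y : R)

@[simp] theorem ev_nil : ev [] x = 0 := rfl

@[simp] theorem ev_cons (c : ℤ) (l : List ℤ) : ev (c :: l) x = c + x * ev l x := rfl

@[simp] theorem ev₂_nil : ev₂ [] x y = 0 := rfl

@[simp] theorem ev₂_cons (l : List ℤ) (L : List (List ℤ)) :
    ev₂ (l :: L) x y = ev l x + y * ev₂ L x y := rfl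

theorem map_ev {R' : Type*} [CommRing R'] (φ : R →+* R') (l : List ℤ) :
    φ (ev l x) = ev l (φ x) := by
  induction l with
  | nil => simp
  | cons c l ih => simp [ih]

theorem map_ev₂ {R' : Type*} [CommRing R'] (φ : R →+* R') (L : List (List ℤ)) :
    φ (ev₂ L x y) = ev₂ L (φ x) (φ y) := by
  induction L with
  | nil => simp
  | cons c l ih => simp [ih, map_ev]

theorem ev_addL (l m : List ℤ) : ev (addL l m) x = ev l x + ev m x := by
  induction l generalizing m with
  | nil => simp [addL]
  | cons a l ih =>
    cases m with
    | nil => simp [addL]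
    | cons b m => simp only [addL, ev_cons, ih]; push_cast; ring

theorem ev_smulL (c : ℤ) (l : List ℤ) : ev (smulL c l) x = c * ev l x := by
  induction l with
  | nil => simp [smulL]
  | cons a l ih =>
    rw [smulL, List.map_cons, ev_cons, ← smulL, ih, ev_cons]
    push_cast
    ring

theorem ev_mulL (l m : List ℤ) : ev (mulL l m) x = ev l x * ev m x := by
  induction l with
  | nil => simp [mulL]
  | cons a l ih => simp only [mulL, ev_addL, ev_smulL, ev_cons, ih]; push_cast; ring

theorem ev_append (l m : List ℤ) : ev (l ++ m) x = ev l x + x ^ l.length * ev m x := by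
  induction l with
  | nil => simp
  | cons a l ih => simp only [List.cons_append, ev_cons, ih, List.length_cons]; ring

theorem ev_replicate_append (n : ℕ) (m : List ℤ) :
    ev (List.replicate n 0 ++ m) x = x ^ n * ev m x := by
  induction n with
  | zero => simp
  | succ n ih => rw [List.replicate_succ, List.cons_append, ev_cons, ih]; push_cast; ring

theorem ev₂_addL₂ (L M : List (List ℤ)) : ev₂ (addL₂ L M) x y = ev₂ L x y + ev₂ M x y := by
  induction L generalizing M with
  | nil => simp [addL₂]
  | cons a l ih =>
    cases M with
    | nil => simp [addL₂]
    | cons b m => simp only [addL₂, ev₂_cons, ih, ev_addL]; ring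

theorem ev₂_map_mulL (l : List ℤ) (M : List (List ℤ)) :
    ev₂ (M.map (mulL l)) x y = ev l x * ev₂ M x y := by
  induction M with
  | nil => simp
  | cons a M ih => simp only [List.map_cons, ev₂_cons, ih, ev_mulL]; ring

theorem ev₂_mulL₂ (L M : List (List ℤ)) : ev₂ (mulL₂ L M) x y = ev₂ L x y * ev₂ M x y := by
  induction L with
  | nil => simp [mulL₂]
  | cons a L ih => simp only [mulL₂, ev₂_addL₂, ev₂_map_mulL, ev₂_cons, ih, ev_nil]; ring

theorem ev₂_singleton (l : List ℤ) : ev₂ [l] x y = ev l x := by simp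

theorem ev₂_map_singleton (l : List ℤ) : ev₂ (l.map fun c ↦ [c]) x y = ev l y := by
  induction l with
  | nil => simp
  | cons a l ih => simp [ih]

theorem ev₂_eq_zero {L : List (List ℤ)} (h : L.all (zeroMod 0) = true) : ev₂ L x y = 0 := by
  induction L with
  | nil => rfl
  | cons l L ih =>
    rw [List.all_cons, Bool.and_eq_true] at h
    have hl : ev l x = 0 := by
      have h1 := h.1
      clear h ih
      induction l with
      | nil => rfl
      | cons a l ih =>
        rw [zeroMod, List.all_cons, Bool.and_eq_true, ← zeroMod] at h1
        have : a = 0 := by simpa using h1.1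
        simp [this, ih h1.2]
    simp [hl, ih h.2]

section CharP

variable {p : ℕ} [CharP R p]

theorem ev_eq_zero {l : List ℤ} (h : zeroMod p l = true) : ev l x = 0 := by
  induction l with
  | nil => rfl
  | cons a l ih =>
    rw [zeroMod, List.all_cons, Bool.and_eq_true, ← zeroMod] at h
    have : (a : R) = 0 := by
      rw [CharP.intCast_eq_zero_iff R p]
      exact Int.dvd_of_emod_eq_zero (by simpa using h.1)
    simp [this, ih h.2]

theorem ev_eq_of_zeroMod {l m : List ℤ} (h : zeroMod p (addL l (smulL (-1) m)) = true) :
    ev l x = ev m x := by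
  have := ev_eq_zero x h
  rw [ev_addL, ev_smulL] at this
  push_cast at this
  linear_combination this

end CharP

theorem derivative_ev_aux (n : ℕ) (l : List ℤ) :
    X * derivative (X ^ n * ev l (X : R[X])) = X ^ n * ev (derivAux n l) (X : R[X]) := by
  induction l generalizing n with
  | nil => simp [derivAux]
  | cons a l ih =>
    have h := ih (n + 1)
    rw [ev_cons, mul_add, ← mul_assoc, ← pow_succ, derivative_add, mul_add, h, derivAux, ev_cons,
      derivative_mul, derivative_intCast, mul_zero, add_zero, derivative_X_pow]
    cases n with
    | zero => simp
    | succ n =>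
      simp only [Nat.add_sub_cancel, map_natCast]
      push_cast
      ring

theorem derivative_ev (l : List ℤ) :
    derivative (ev l (X : R[X])) = ev (derivAux 0 l).tail (X : R[X]) := by
  cases l with
  | nil => simp [derivAux]
  | cons a l =>
    have h := derivative_ev_aux (R := R) 0 (a :: l)
    simp only [pow_zero, one_mul, derivAux, ev_cons] at h ⊢
    simp only [Nat.cast_zero, zero_mul, Int.cast_zero, zero_add, List.tail_cons] at h ⊢
    exact isRegular_X.left h

end CoefficientLists

section FrobeniusPowers

/-- Linear combination of coefficient lists. -/
def comb : List ℤ → List (List ℤ) → List ℤ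
  | [], _ => []
  | _ :: _, [] => []
  | c :: h, r :: L => addL (smulL c r) (comb h L)

/-- Modulo `p` and `f`, each list in `r :: L` is `x ^ p` times its predecessor; the second
components are the quotients. -/
def checkRows (p : ℕ) (f : List ℤ) : List ℤ → List (List ℤ × List ℤ) → Bool
  | _, [] => true
  | r, r' :: L => zeroMod p (addL (List.replicate p 0 ++ r)
      (smulL (-1) (addL r'.1 (mulL r'.2 f)))) && checkRows p f r'.1 L

/-- Each list in `h :: L` is the `p`-th power of its predecessor, and the last one is `x`, where
`rows` are the powers of `x ^ p`. -/
def checkChain (p : ℕ) (rows : List (List ℤ)) : List ℤ → List (List ℤ) → Bool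
  | h, [] => zeroMod p (addL h (smulL (-1) [0, 1]))
  | h, h' :: L => zeroMod p (addL (comb h rows) (smulL (-1) h')) &&
      (decide (h.length ≤ rows.length) && checkChain p rows h' L)

variable {k : Type*} [Field k] {p : ℕ} [CharP k p] {f : List ℤ} {α : k}

theorem ev_comb (hα : ev f α = 0) (h r : List ℤ) (L : List (List ℤ × List ℤ))
    (hL : checkRows p f r L = true) (hlen : h.length ≤ L.length + 1) :
    ev (comb h (r :: L.map Prod.fst)) α = ev r α * ev h (α ^ p) := by
  induction h generalizing r L with
  | nil => simp [comb]
  | cons c h ih =>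
    rw [comb, ev_addL, ev_smulL, ev_cons]
    cases L with
    | nil =>
      obtain rfl : h = [] := List.length_eq_zero_iff.1 (by simpa using hlen)
      simp [comb, mul_comm]
    | cons r' L =>
      rw [checkRows, Bool.and_eq_true] at hL
      have h1 := ev_eq_of_zeroMod α hL.1
      rw [ev_replicate_append, ev_addL, ev_mulL, hα, mul_zero, add_zero] at h1
      rw [List.map_cons, ih _ _ hL.2 (by simpa using hlen), ← h1]
      ring

theorem pow_eq_of_checkChain [Fact p.Prime] (hα : ev f α = 0) {rows : List (List ℤ × List ℤ)}
    (hrows : checkRows p f [1] rows = true) {h : List ℤ} {L : List (List ℤ)}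
    (hL : checkChain p ([1] :: rows.map Prod.fst) h L = true) :
    ev h α ^ p ^ L.length = α := by
  induction L generalizing h with
  | nil =>
    have := ev_eq_of_zeroMod α hL
    simpa using this
  | cons h' L ih =>
    rw [checkChain, Bool.and_eq_true, Bool.and_eq_true, decide_eq_true_iff] at hL
    have h1 := ev_eq_of_zeroMod α hL.1
    rw [ev_comb hα h [1] rows hrows (by simpa using hL.2.1)] at h1
    have h2 : ev h (α ^ p) = ev h α ^ p := (map_ev α (frobenius k p) h).symm
    rw [h2, ev_cons, ev_nil, mul_zero, add_zero, Int.cast_one, one_mul] at h1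
    rw [List.length_cons, pow_succ', pow_mul, h1, ih hL.2.2]

theorem exists_natCast_of_pow_eq [Fact p.Prime] {y : k} (hy : y ^ p = y) :
    ∃ c < p, y = (c : k) := by
  let := ZMod.algebra k p
  have h1 := (Subfield.mem_bot_iff_pow_eq_self (F := k) (p := p)).2 hy
  have h2 : (⊥ : Subfield k) ≤ (algebraMap (ZMod p) k).fieldRange := bot_le
  obtain ⟨c, rfl⟩ := h2 h1
  refine ⟨c.val, ZMod.val_lt c, ?_⟩
  rw [← map_natCast (algebraMap (ZMod p) k), ZMod.natCast_zmod_val]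

theorem separable_ev {f u v : List ℤ} (h : zeroMod p (addL (addL (mulL u f)
    (mulL v (derivAux 0 f).tail)) [-1]) = true) : (ev f (X : k[X])).Separable := by
  refine ⟨ev u X, ev v X, ?_⟩
  have := ev_eq_zero (X : k[X]) h
  rw [ev_addL, ev_addL, ev_mulL, ev_mulL, ← derivative_ev] at this
  simp at this
  linear_combination this

end FrobeniusPowers

section Roots

variable {K E : Type*} [Field K] [Field E] [Algebra K E] [Algebra ℤ[X] K] [Algebra ℤ[X] E]
  [IsScalarTower ℤ[X] K E]

/-- The roots of a polynomial in the integral closure of `ℤ[t]`. -/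
abbrev IntegralRoot (E : Type*) [Field E] [Algebra ℤ[X] E] (h : ℤ[X][X]) : Type _ :=
  {s : integralClosure ℤ[X] E // aeval s h = 0}

noncomputable instance (h : ℤ[X][X]) : MulAction (E ≃ₐ[K] E) (IntegralRoot E h) where
  smul σ s := ⟨σ • s.1, by
    have := aeval_algHom_apply
      (MulSemiringAction.toAlgHom ℤ[X] (integralClosure ℤ[X] E) σ) s.1 h
    rwa [s.2, map_zero] at this⟩
  one_smul s := Subtype.ext (one_smul _ s.1)
  mul_smul σ τ s := Subtype.ext (mul_smul σ τ s.1)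

theorem IntegralRoot.coe_smul {h : ℤ[X][X]} (σ : E ≃ₐ[K] E) (s : IntegralRoot E h) :
    (σ • s).1 = σ • s.1 := rfl

theorem IntegralRoot.mem_roots {h : ℤ[X][X]} (hh : h.Monic) (s : IntegralRoot E h) :
    s.1 ∈ (h.map (algebraMap ℤ[X] (integralClosure ℤ[X] E))).roots := by
  rw [Polynomial.mem_roots (hh.map _).ne_zero, IsRoot.def, eval_map_algebraMap, s.2]

theorem finite_integralRoot {h : ℤ[X][X]} (hh : h.Monic) : Finite (IntegralRoot E h) := by
  exact Set.Finite.subset (t := {s | aeval s h = 0}) (Multiset.finite_toSet _) fun s hs ↦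
    IntegralRoot.mem_roots hh ⟨s, hs⟩

theorem card_integralRoot_le {h : ℤ[X][X]} (hh : h.Monic) :
    Nat.card (IntegralRoot E h) ≤ h.natDegree := by
  classical
  let M := (h.map (algebraMap ℤ[X] (integralClosure ℤ[X] E))).roots
  calc Nat.card (IntegralRoot E h)
      ≤ Nat.card M.toFinset :=
        Nat.card_le_card_of_injective
          (fun s ↦ ⟨s.1, Multiset.mem_toFinset.2 (s.mem_roots hh)⟩) fun a b hab ↦ by
            have := Subtype.ext_iff.1 hab
            exact Subtype.ext this
    _ ≤ M.card := by
        rw [Nat.card_eq_fintype_card, Fintype.card_coe]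
        exact Multiset.toFinset_card_le _
    _ ≤ h.natDegree := (card_roots' _).trans natDegree_map_le

theorem exists_eq_prod_integralRoot {h : ℤ[X][X]} (hh : h.Monic)
    (hs : (h.map (algebraMap ℤ[X] E)).Splits) [FaithfulSMul ℤ[X] E] :
    ∃ M : Multiset (IntegralRoot E h), h.map (algebraMap ℤ[X] (integralClosure ℤ[X] E)) =
      (M.map fun s ↦ X - C s.1).prod := by
  have h1 := hs.eq_prod_roots_of_monic (hh.map _)
  have hroot : ∀ x ∈ (h.map (algebraMap ℤ[X] E)).roots, aeval x h = 0 := by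
    intro x hx
    have := isRoot_of_mem_roots hx
    rwa [IsRoot.def, eval_map_algebraMap] at this
  have hinj : Function.Injective (algebraMap (integralClosure ℤ[X] E) E) :=
    Subtype.val_injective
  generalize (h.map (algebraMap ℤ[X] E)).roots = N at h1 hroot
  have : ∃ M : Multiset (IntegralRoot E h), M.map (fun s ↦ (s.1 : E)) = N := by
    have hint (x) (hx : aeval x h = 0) : x ∈ integralClosure ℤ[X] E := ⟨h, hh, hx⟩
    have hz (x) (hx : aeval x h = 0) :
        aeval (⟨x, hint x hx⟩ : integralClosure ℤ[X] E) h = 0 := by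
      apply hinj
      rw [← aeval_algebraMap_apply, map_zero]
      exact hx
    refine ⟨N.pmap (fun x hx ↦ ⟨⟨x, hint x hx⟩, hz x hx⟩) hroot, ?_⟩
    rw [Multiset.map_pmap]
    exact (Multiset.pmap_eq_map _ id N hroot).trans (Multiset.map_id N)
  obtain ⟨M, rfl⟩ := this
  refine ⟨M, map_injective _ hinj ?_⟩
  rw [map_map, ← IsScalarTower.algebraMap_eq, h1, Polynomial.map_multiset_prod, Multiset.map_map,
    Multiset.map_map]
  congr 1
  apply Multiset.map_congr rfl
  intro x _
  simp

variable {k : Type*} [Field k] (r : integralClosure ℤ[X] E →+* k)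

/-- Every root of the reduction of a split monic polynomial is the reduction of a root. -/
theorem exists_integralRoot_reduction_eq {h : ℤ[X][X]} (hh : h.Monic)
    (hs : (h.map (algebraMap ℤ[X] E)).Splits) [FaithfulSMul ℤ[X] E] {α : k}
    (hα : (h.map (r.comp (algebraMap ℤ[X] _))).eval α = 0) :
    ∃ s : IntegralRoot E h, r s.1 = α := by
  obtain ⟨M, hM⟩ := exists_eq_prod_integralRoot hh hs
  rw [← map_map, hM, Polynomial.map_multiset_prod, Multiset.map_map, eval_multiset_prod,
    Multiset.map_map, Multiset.prod_eq_zero_iff, Multiset.mem_map] at hα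
  obtain ⟨s, -, hs⟩ := hα
  exact ⟨s, (sub_eq_zero.1 (by simpa using hs)).symm⟩

/-- If the reduction of a split monic polynomial is separable, its roots have distinct
reductions. -/
theorem reduction_injective {h : ℤ[X][X]} (hh : h.Monic)
    (hs : (h.map (algebraMap ℤ[X] E)).Splits) [FaithfulSMul ℤ[X] E]
    (hsep : (h.map (r.comp (algebraMap ℤ[X] _))).Separable) :
    Function.Injective fun s : IntegralRoot E h ↦ r s.1 := by
  obtain ⟨M, hM⟩ := exists_eq_prod_integralRoot hh hs
  have hmem : ∀ s : IntegralRoot E h, s ∈ M := by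
    intro s
    have h1 := congrArg (eval s.1) hM
    rw [eval_map_algebraMap, s.2, eval_multiset_prod, Multiset.map_map, eq_comm,
      Multiset.prod_eq_zero_iff, Multiset.mem_map] at h1
    obtain ⟨s', hs', h2⟩ := h1
    have : s = s' := Subtype.ext (by simpa [sub_eq_zero] using h2)
    exact this ▸ hs'
  rw [← map_map, hM, Polynomial.map_multiset_prod, Multiset.map_map] at hsep
  have h3 : (M.map fun s ↦ r s.1).Nodup := by
    have := nodup_roots hsep
    have h4 : (Multiset.map (Polynomial.map r ∘ fun s : IntegralRoot E h ↦ X - C s.1) M) =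
        (M.map fun s ↦ r s.1).map fun a ↦ X - C a := by
      rw [Multiset.map_map]
      apply Multiset.map_congr rfl
      simp
    rwa [h4, roots_multiset_prod_X_sub_C] at this
  exact fun a b hab ↦ Multiset.inj_on_of_nodup_map h3 a (hmem a) b (hmem b) hab

end Roots

theorem isPretransitive_of_pow {H X : Type*} [Group H] [MulAction H X] [Finite X] {n : ℕ}
    (hn : n.Prime) (hX : Nat.card X = n) (u : H) (hu : ∀ x : X, u ^ n • x = x)
    (hfix : ∀ x : X, u • x ≠ x) : MulAction.IsPretransitive H X := by
  have key (x : X) : MulAction.orbit (Subgroup.zpowers u) x = Set.univ := by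
    have := Fintype.ofFinite (MulAction.orbit (Subgroup.zpowers u) x)
    apply (Set.eq_univ_iff_ncard _).2
    rw [hX, ← Nat.card_coe_set_eq, Nat.card_eq_fintype_card, ← MulAction.minimalPeriod_eq_card]
    have h1 : Function.minimalPeriod (u • ·) x ∣ n := by
      apply Function.IsPeriodicPt.minimalPeriod_dvd
      rw [Function.IsPeriodicPt, Function.IsFixedPt, smul_iterate]
      exact hu x
    refine ((Nat.dvd_prime hn).1 h1).resolve_left fun h2 ↦ hfix x ?_
    exact Function.minimalPeriod_eq_one_iff_isFixedPt.1 h2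
  refine ⟨fun x y ↦ ?_⟩
  obtain ⟨g, hg⟩ := (key x).symm ▸ Set.mem_univ y
  exact ⟨g, hg⟩

section Pencils

/-- The polynomial `x ^ 31 + l(x) - t * m(x)` over `ℤ[t]`. -/
noncomputable def pencil (l m : List ℤ) : ℤ[X][X] :=
  X ^ 31 + (ev l (X : ℤ[X][X]) - C X * ev m (X : ℤ[X][X]))

/-- Coefficients of the specialization of a pencil at an integer. -/
def specialize (l m : List ℤ) (t : ℤ) : List ℤ := addL (l ++ [1]) (smulL (-t) m)

theorem degree_ev_lt {R : Type*} [CommRing R] (l : List ℤ) :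
    (ev l (X : R[X])).degree < (l.length : WithBot ℕ) := by
  rw [degree_lt_iff_coeff_zero]
  induction l with
  | nil => simp
  | cons a l ih =>
    intro n hn
    obtain ⟨n, rfl⟩ : ∃ i, n = i + 1 := ⟨n - 1, by simp at hn; omega⟩
    rw [ev_cons, coeff_add, coeff_X_mul, ih n (by simpa using hn), ← C_eq_intCast, coeff_C_succ,
      add_zero]

theorem degree_pencil_aux {l m : List ℤ} (hl : l.length = 31) (hm : m.length ≤ 31) :
    (ev l (X : ℤ[X][X]) - C X * ev m (X : ℤ[X][X])).degree < ((31 : ℕ) : WithBot ℕ) := by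
  refine (degree_sub_le _ _).trans_lt (max_lt (hl ▸ degree_ev_lt l) ?_)
  refine (degree_C_mul X_ne_zero).le.trans_lt ((degree_ev_lt m).trans_le ?_)
  exact_mod_cast hm

theorem monic_pencil {l m : List ℤ} (hl : l.length = 31) (hm : m.length ≤ 31) :
    (pencil l m).Monic :=
  monic_X_pow_add (degree_pencil_aux hl hm)

theorem natDegree_pencil {l m : List ℤ} (hl : l.length = 31) (hm : m.length ≤ 31) :
    (pencil l m).natDegree = 31 := by
  rw [pencil, natDegree_add_eq_left_of_degree_lt, natDegree_X_pow]
  rw [degree_X_pow]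
  exact degree_pencil_aux hl hm

theorem map_pencil {R : Type*} [CommRing R] (φ : ℤ[X] →+* R) (l m : List ℤ) :
    (pencil l m).map φ = X ^ 31 + (ev l (X : R[X]) - C (φ X) * ev m (X : R[X])) := by
  simp only [pencil, Polynomial.map_add, Polynomial.map_sub, Polynomial.map_mul,
    Polynomial.map_pow, map_X, map_C]
  rw [← coe_mapRingHom, map_ev, map_ev, coe_mapRingHom, map_X]

theorem map_pencil_eq_ev {R : Type*} [CommRing R] (φ : ℤ[X] →+* R) {l m : List ℤ} {t : ℤ}
    (hφ : φ X = t) (hl : l.length = 31) :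
    (pencil l m).map φ = ev (specialize l m t) (X : R[X]) := by
  rw [map_pencil, specialize, ev_addL, ev_append, hl, ev_smulL, hφ, ev_cons, ev_nil, map_intCast]
  push_cast
  ring

theorem aeval_pencil {R : Type*} [CommRing R] [Algebra ℤ[X] R] (l m : List ℤ) (s : R) :
    aeval s (pencil l m) = s ^ 31 + (ev l s - algebraMap ℤ[X] R X * ev m s) := by
  rw [← eval_map_algebraMap, map_pencil]
  simp only [eval_add, eval_pow, eval_X, eval_sub, eval_mul, eval_C]
  rw [← coe_evalRingHom, map_ev, map_ev, coe_evalRingHom, eval_X]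

end Pencils

section Specialization

variable {K E : Type*} [Field K] [Field E] [Algebra K E] [Algebra ℤ[X] K] [Algebra ℤ[X] E]
  [IsScalarTower ℤ[X] K E] {k : Type*} [Field k] {p : ℕ}
  {r : integralClosure ℤ[X] E →+* k} {t : ℤ} (hr : r (algebraMap ℤ[X] _ X) = t)
  {l m : List ℤ} (hl : l.length = 31) (hm : m.length ≤ 31)
  (hs : ((pencil l m).map (algebraMap ℤ[X] E)).Splits)

include hr hl

theorem ev_specialize_reduction (s : IntegralRoot E (pencil l m)) :
    ev (specialize l m t) (r s.1) = 0 := by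
  have h1 := congrArg r s.2
  rw [aeval_def, hom_eval₂, ← eval_map, map_pencil_eq_ev (r.comp _) hr hl, ← coe_evalRingHom,
    map_ev, coe_evalRingHom, eval_X, map_zero] at h1
  exact h1

include hm hs

variable [FaithfulSMul ℤ[X] E]

theorem exists_integralRoot_pencil {α : k} (hα : ev (specialize l m t) α = 0) :
    ∃ s : IntegralRoot E (pencil l m), r s.1 = α := by
  apply exists_integralRoot_reduction_eq r (monic_pencil hl hm) hs
  rw [map_pencil_eq_ev (r.comp _) hr hl, ← coe_evalRingHom, map_ev, coe_evalRingHom, eval_X, hα]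

theorem reduction_pencil_injective [CharP k p] {u v : List ℤ}
    (h : zeroMod p (addL (addL (mulL u (specialize l m t))
      (mulL v (derivAux 0 (specialize l m t)).tail)) [-1]) = true) :
    Function.Injective fun s : IntegralRoot E (pencil l m) ↦ r s.1 := by
  apply reduction_injective r (monic_pencil hl hm) hs
  rw [map_pencil_eq_ev (r.comp _) hr hl]
  exact separable_ev h

end Specialization

section EvaluationMod

/-- Evaluation of a coefficient list at an integer modulo `p`. -/
def evMod (p : ℕ) (l : List ℤ) (x : ℤ) : ℤ := l.foldr (fun c s ↦ (c + x * s) % p) 0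

/-- Evaluation of a bivariate coefficient list at integers modulo `p`. -/
def ev₂Mod (p : ℕ) (L : List (List ℤ)) (x y : ℤ) : ℤ :=
  L.foldr (fun l s ↦ (evMod p l x + y * s) % p) 0

variable {k : Type*} [Field k] {p : ℕ} [CharP k p]

variable (k) in
theorem intCast_emod_charP (a : ℤ) : ((a % p : ℤ) : k) = a := by
  rw [CharP.intCast_eq_intCast k p]
  exact Int.mod_modEq a p

variable (k) in
theorem intCast_evMod (l : List ℤ) (x : ℤ) : ((evMod p l x : ℤ) : k) = ev l (x : k) := by
  induction l with
  | nil => simp [evMod]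
  | cons a l ih =>
    rw [evMod, List.foldr_cons, ← evMod, intCast_emod_charP, ev_cons, ← ih]
    push_cast
    rfl

variable (k) in
theorem intCast_ev₂Mod (L : List (List ℤ)) (x y : ℤ) :
    ((ev₂Mod p L x y : ℤ) : k) = ev₂ L (x : k) (y : k) := by
  induction L with
  | nil => simp [ev₂Mod]
  | cons a l ih =>
    rw [ev₂Mod, List.foldr_cons, ← ev₂Mod, intCast_emod_charP, ev₂_cons, ← ih, ← intCast_evMod k]
    push_cast
    rfl

theorem ev_intCast_eq_zero_iff {l : List ℤ} {x : ℤ} :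
    ev l (x : k) = 0 ↔ evMod p l x % p = 0 := by
  rw [← intCast_evMod k, CharP.intCast_eq_zero_iff k p, Int.dvd_iff_emod_eq_zero]

theorem ev₂_intCast_eq_zero_iff {L : List (List ℤ)} {x y : ℤ} :
    ev₂ L (x : k) (y : k) = 0 ↔ ev₂Mod p L x y % p = 0 := by
  rw [← intCast_ev₂Mod k, CharP.intCast_eq_zero_iff k p, Int.dvd_iff_emod_eq_zero]

end EvaluationMod

/-- Certificate for the separability of a polynomial modulo `p`. -/
def sepCheck (p : ℕ) (f u v : List ℤ) : Bool :=
  zeroMod p (addL (addL (mulL u f) (mulL v (derivAux 0 f).tail)) [-1])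

section Places

variable {K : Type*} {E : Type uE} [Field K] [Field E] [Algebra K E] [Algebra ℤ[X] K]
  [Algebra ℤ[X] E] [IsScalarTower ℤ[X] K E]

section Frobenius

variable {k : Type*} [Field k] {p : ℕ} {r : integralClosure ℤ[X] E →+* k} {u : E ≃ₐ[K] E}
  (hu : ∀ s, r (u • s) = r s ^ p)

include hu

theorem reduction_pow_smul (n : ℕ) (s : integralClosure ℤ[X] E) :
    r (u ^ n • s) = r s ^ p ^ n := by
  induction n with
  | zero => simp
  | succ n ih => rw [pow_succ', mul_smul, hu, ih, ← pow_mul, pow_succ]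

variable [Fact p.Prime] [CharP k p]

theorem exists_reduction_eq_of_smul_eq {s : integralClosure ℤ[X] E} (hs : u • s = s) :
    ∃ c < p, r s = (c : k) := by
  apply exists_natCast_of_pow_eq
  rw [← hu, hs]

theorem smul_eq_of_reduction_eq {h : ℤ[X][X]}
    (hinj : Function.Injective fun s : IntegralRoot E h ↦ r s.1) {s : IntegralRoot E h} {c : ℕ}
    (hs : r s.1 = c) : u • s = s := by
  apply hinj
  simp only [IntegralRoot.coe_smul, hu, hs]
  rw [← frobenius_def, map_natCast]

theorem pow_smul_eq_of_checkChain {l m : List ℤ} {t : ℤ} (hr : r (algebraMap ℤ[X] _ X) = t)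
    (hl : l.length = 31)
    (hinj : Function.Injective fun s : IntegralRoot E (pencil l m) ↦ r s.1)
    {rows : List (List ℤ × List ℤ)} (hrows : checkRows p (specialize l m t) [1] rows = true)
    {L : List (List ℤ)} (hL : checkChain p ([1] :: rows.map Prod.fst) [0, 1] L = true)
    (s : IntegralRoot E (pencil l m)) : u ^ L.length • s = s := by
  apply hinj
  have h := pow_eq_of_checkChain (ev_specialize_reduction hr hl s) hrows hL
  simp only [IntegralRoot.coe_smul, reduction_pow_smul hu]
  simpa using h

end Frobenius

variable [FiniteDimensional K E] [IsGalois K E] [IsFractionRing ℤ[X] K]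

variable (K E) in
theorem exists_specialization (p : ℕ) [Fact p.Prime] (t : ℤ) :
    ∃ (k : Type uE) (_ : Field k) (_ : CharP k p) (r : integralClosure ℤ[X] E →+* k)
      (u : E ≃ₐ[K] E), r (algebraMap ℤ[X] _ X) = t ∧ ∀ s, r (u • s) = r s ^ p := by
  obtain ⟨k, hk, hpk, r, u, h1, h2⟩ := exists_reduction_and_frobenius (K := K) (E := E)
    ((Int.castRingHom (ZMod p)).comp (evalRingHom t))
  refine ⟨k, hk, charP_of_injective_algebraMap (algebraMap (ZMod p) k).injective p, r, u, ?_, h2⟩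
  rw [h1]
  simp

variable [FaithfulSMul ℤ[X] E] {l m : List ℤ} (hl : l.length = 31) (hm : m.length ≤ 31)
  (hs : ((pencil l m).map (algebraMap ℤ[X] E)).Splits) (p : ℕ) [Fact p.Prime] (t : ℤ)
  {v w : List ℤ} (hsep : sepCheck p (specialize l m t) v w = true)

include hl hm hs hsep

variable (K) in
theorem isPretransitive_of_specialization (hcard : Nat.card (IntegralRoot E (pencil l m)) = 31)
    {rows : List (List ℤ × List ℤ)} (hrows : checkRows p (specialize l m t) [1] rows = true)
    {L : List (List ℤ)} (hL : checkChain p ([1] :: rows.map Prod.fst) [0, 1] L = true)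
    (hlen : L.length = 31)
    (hroots : ∀ c < p, evMod p (specialize l m t) (c : ℕ) % p ≠ 0) :
    MulAction.IsPretransitive (E ≃ₐ[K] E) (IntegralRoot E (pencil l m)) := by
  obtain ⟨k, _, _, r, u, hr, hu⟩ := exists_specialization K E p t
  have := finite_integralRoot (E := E) (monic_pencil hl hm)
  have hinj := reduction_pencil_injective hr hl hm hs hsep
  refine isPretransitive_of_pow (by norm_num) hcard u
    (hlen ▸ pow_smul_eq_of_checkChain hu hr hl hinj hrows hL) fun s hs ↦ ?_
  obtain ⟨c, hc, hsc⟩ := exists_reduction_eq_of_smul_eq hu (congrArg Subtype.val hs)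
  refine hroots c hc (ev_intCast_eq_zero_iff (k := k).1 ?_)
  rw [Int.cast_natCast, ← hsc]
  exact ev_specialize_reduction hr hl s

variable (K) in
theorem exists_smul_eq_and_pow_smul_eq
    {rows : List (List ℤ × List ℤ)} (hrows : checkRows p (specialize l m t) [1] rows = true)
    {L : List (List ℤ)} (hL : checkChain p ([1] :: rows.map Prod.fst) [0, 1] L = true)
    {a : ℕ} (ha : evMod p (specialize l m t) a % p = 0) {B : List (List ℤ)}
    (hB : ∀ c < p, ev₂Mod p B a (c : ℕ) % p ≠ 0) (h : ℤ[X][X]) :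
    ∃ (u : E ≃ₐ[K] E) (x : IntegralRoot E (pencil l m)), u • x = x ∧
      (∀ x : IntegralRoot E (pencil l m), u ^ L.length • x = x) ∧
      ∀ y : IntegralRoot E h, ev₂ B x.1 y.1 = 0 → u • y ≠ y := by
  obtain ⟨k, _, _, r, u, hr, hu⟩ := exists_specialization K E p t
  have hinj := reduction_pencil_injective hr hl hm hs hsep
  obtain ⟨x, hx⟩ := exists_integralRoot_pencil hr hl hm hs
    (ev_intCast_eq_zero_iff (k := k).2 ha)
  refine ⟨u, x, smul_eq_of_reduction_eq hu hinj (c := a) (by simpa using hx),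
    pow_smul_eq_of_checkChain hu hr hl hinj hrows hL, fun y hy hy' ↦ ?_⟩
  obtain ⟨c, hc, hyc⟩ := exists_reduction_eq_of_smul_eq hu (congrArg Subtype.val hy')
  refine hB c hc (ev₂_intCast_eq_zero_iff (k := k).1 ?_)
  rw [Int.cast_natCast, Int.cast_natCast, ← hyc, ← Int.cast_natCast, ← hx, ← map_ev₂, hy, map_zero]

variable (K) in
theorem exists_card_fixed (hcard : Nat.card (IntegralRoot E (pencil l m)) = 31) {n : ℕ}
    (hn : n < 31)
    (hroots : ((Finset.range p).filter fun c : ℕ ↦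
      evMod p (specialize l m t) c % p = 0).card = n) :
    ∃ τ : E ≃ₐ[K] E, n ≤ Nat.card {x : IntegralRoot E (pencil l m) // τ • x = x} ∧
      ∃ x : IntegralRoot E (pencil l m), τ • x ≠ x := by
  obtain ⟨k, _, _, r, u, hr, hu⟩ := exists_specialization K E p t
  have := finite_integralRoot (E := E) (monic_pencil hl hm)
  have hinj := reduction_pencil_injective hr hl hm hs hsep
  set R := (Finset.range p).filter fun c : ℕ ↦ evMod p (specialize l m t) c % p = 0 with hR
  have hRn : Nat.card R = n := by rw [Nat.card_eq_fintype_card, Fintype.card_coe, hroots]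
  have hcast {a b : R} (hab : ((a : ℕ) : k) = (b : ℕ)) : a = b := by
    have ha := Finset.mem_range.1 (Finset.mem_filter.1 a.2).1
    have hb := Finset.mem_range.1 (Finset.mem_filter.1 b.2).1
    have := (CharP.natCast_eq_natCast k p).1 hab
    exact Subtype.ext (Nat.ModEq.eq_of_lt_of_lt this ha hb)
  refine ⟨u, ?_, ?_⟩
  · have key (c : R) : ∃ s : IntegralRoot E (pencil l m), r s.1 = (c : ℕ) := by
      obtain ⟨s, hs⟩ := exists_integralRoot_pencil hr hl hm hs
        (ev_intCast_eq_zero_iff (k := k).2 (Finset.mem_filter.1 c.2).2)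
      exact ⟨s, by simpa using hs⟩
    choose s hs using key
    rw [← hRn]
    refine Nat.card_le_card_of_injective
      (fun c ↦ ⟨s c, smul_eq_of_reduction_eq hu hinj (hs c)⟩) fun a b hab ↦ ?_
    have h1 := Subtype.ext_iff.1 hab
    exact hcast ((hs a).symm.trans ((congrArg (fun s ↦ r s.1) h1).trans (hs b)))
  · by_contra! hall
    have key (s : IntegralRoot E (pencil l m)) : ∃ c : R, r s.1 = (c : ℕ) := by
      obtain ⟨c, hc, hsc⟩ := exists_reduction_eq_of_smul_eq hu (congrArg Subtype.val (hall s))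
      refine ⟨⟨c, Finset.mem_filter.2 ⟨Finset.mem_range.2 hc,
        ev_intCast_eq_zero_iff (k := k).1 ?_⟩⟩, hsc⟩
      rw [Int.cast_natCast, ← hsc]
      exact ev_specialize_reduction hr hl s
    choose c hc using key
    have := Nat.card_le_card_of_injective c fun a b hab ↦
      hinj ((hc a).trans ((congrArg (fun c : R ↦ ((c : ℕ) : k)) hab).trans (hc b).symm))
    omega

end Places

section Codes

/-- The integer with given binary digits. -/
def code (v : Fin 5 → ZMod 2) : ℕ :=
  (v 0).val + 2 * (v 1).val + 4 * (v 2).val + 8 * (v 3).val + 16 * (v 4).val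

/-- Two integers have an even number of common binary digits equal to `1`. -/
def evenInter (m n : ℕ) : Bool :=
  ((List.range 5).countP fun i ↦ (m &&& n).testBit i) % 2 == 0

theorem code_mem_Ico {v : Fin 5 → ZMod 2} (hv : v ≠ 0) : 1 ≤ code v ∧ code v < 32 := by
  revert v
  decide +kernel

theorem code_injective : Function.Injective code := by
  have : ∀ v w, code v = code w → v = w := by decide +kernel
  exact this

theorem evenInter_code : ∀ v φ, evenInter (code v) (code φ) = true ↔ φ ⬝ᵥ v = 0 := by
  decide +kernel

theorem card_ne_zero : Nat.card {v : Fin 5 → ZMod 2 // v ≠ 0} = 31 := by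
  rw [Nat.card_eq_fintype_card]
  decide +kernel

end Codes

section Labelling

variable {K : Type*} {E : Type uE} [Field K] [Field E] [Algebra K E] [Algebra ℤ[X] K]
  [Algebra ℤ[X] E] [IsScalarTower ℤ[X] K E]

/-- The entries of the table `a` with index between `1` and `31` are distinct roots modulo `p` of
the polynomial with coefficient list `f`. -/
def IsRootTable (p : ℕ) (f a : List ℤ) : Prop :=
  ∀ m < 32, 1 ≤ m → evMod p f (a.getD m 0) % p = 0 ∧
    ∀ n < 32, 1 ≤ n → a.getD m 0 % p = a.getD n 0 % p → m = n

instance (p : ℕ) (f a : List ℤ) : Decidable (IsRootTable p f a) := by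
  unfold IsRootTable
  infer_instance

/-- Modulo `p`, the polynomial `A` does not vanish at pairs of labels with odd intersection, and
`B` does not vanish at pairs of labels with even intersection. -/
def IsIncidenceTable (p : ℕ) (A B : List (List ℤ)) (a b : List ℤ) : Prop :=
  ∀ m < 32, 1 ≤ m → ∀ n < 32, 1 ≤ n →
    ev₂Mod p (bif evenInter m n then B else A) (a.getD m 0) (b.getD n 0) % p ≠ 0

instance (p : ℕ) (A B : List (List ℤ)) (a b : List ℤ) : Decidable (IsIncidenceTable p A B a b) := by
  unfold IsIncidenceTable
  infer_instance

variable {k : Type*} [Field k] {p : ℕ} [CharP k p]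
  {r : integralClosure ℤ[X] E →+* k}

variable (K) in
theorem isProjectiveLabelling_of_isIncidenceTable {h h' : ℤ[X][X]}
    {eX : {v : Fin 5 → ZMod 2 // v ≠ 0} ≃ IntegralRoot E h}
    {eY : {v : Fin 5 → ZMod 2 // v ≠ 0} ≃ IntegralRoot E h'} {a b : List ℤ}
    (heX : ∀ v, r (eX v).1 = (a.getD (code v.1) 0 : ℤ))
    (heY : ∀ v, r (eY v).1 = (b.getD (code v.1) 0 : ℤ)) {A B : List (List ℤ)}
    (hAB : ∀ (x : IntegralRoot E h) (y : IntegralRoot E h'),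
      ev₂ A x.1 y.1 * ev₂ B x.1 y.1 = 0)
    (htable : IsIncidenceTable p A B a b) :
    IsProjectiveLabelling (E ≃ₐ[K] E) eX eY fun x y ↦ ev₂ A x.1 y.1 = 0 where
  smul_iff σ x y := by
    rw [IntegralRoot.coe_smul, IntegralRoot.coe_smul, ← smul_eq_zero_iff_eq σ (x := ev₂ A x.1 y.1)]
    exact Eq.congr_left (map_ev₂ x.1 y.1 (MulSemiringAction.toRingHom _ _ σ) A).symm
  iff_dotProduct v φ := by
    have h1 := htable _ (code_mem_Ico v.2).2 (code_mem_Ico v.2).1 _ (code_mem_Ico φ.2).2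
      (code_mem_Ico φ.2).1
    rw [Ne, ← ev₂_intCast_eq_zero_iff (k := k), ← heX, ← heY, ← map_ev₂] at h1
    rw [← evenInter_code]
    cases hc : evenInter (code v.1) (code φ.1) with
    | false =>
      simp only [hc, cond_false] at h1
      simp only [Bool.false_eq_true, iff_false]
      exact fun h2 ↦ h1 (by rw [h2, map_zero])
    | true =>
      simp only [hc, cond_true] at h1
      simp only [iff_true]
      exact (mul_eq_zero.1 (hAB _ _)).resolve_right fun h2 ↦ h1 (by rw [h2, map_zero])

theorem exists_labelling [FaithfulSMul ℤ[X] E] {t : ℤ} (hr : r (algebraMap ℤ[X] _ X) = t)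
    {l m : List ℤ} (hl : l.length = 31)
    (hm : m.length ≤ 31) (hs : ((pencil l m).map (algebraMap ℤ[X] E)).Splits) {a : List ℤ}
    (ha : IsRootTable p (specialize l m t) a) :
    ∃ e : {v : Fin 5 → ZMod 2 // v ≠ 0} ≃ IntegralRoot E (pencil l m),
      ∀ v, r (e v).1 = (a.getD (code v.1) 0 : ℤ) := by
  have := finite_integralRoot (E := E) (monic_pencil hl hm)
  have key (v : {v : Fin 5 → ZMod 2 // v ≠ 0}) :
      ∃ s : IntegralRoot E (pencil l m), r s.1 = (a.getD (code v.1) 0 : ℤ) :=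
    exists_integralRoot_pencil hr hl hm hs (ev_intCast_eq_zero_iff.2
      (ha _ (code_mem_Ico v.2).2 (code_mem_Ico v.2).1).1)
  choose e he using key
  refine ⟨Equiv.ofBijective e (Function.Injective.bijective_of_nat_card_le (fun v w hvw ↦ ?_) ?_),
    he⟩
  · have h1 : ((a.getD (code v.1) 0 : ℤ) : k) = (a.getD (code w.1) 0 : ℤ) := by
      rw [← he, ← he, hvw]
    rw [CharP.intCast_eq_intCast k p] at h1
    exact Subtype.ext (code_injective ((ha _ (code_mem_Ico v.2).2 (code_mem_Ico v.2).1).2 _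
      (code_mem_Ico w.2).2 (code_mem_Ico w.2).1 h1))
  · rw [card_ne_zero, ← natDegree_pencil hl hm]
    exact card_integralRoot_le (monic_pencil hl hm)

end Labelling

section Data

/-- Lower coefficients of the numerator of the covering `x ↦ t` defining `fTilde`. -/
def coverNum : List ℤ :=
  [-5184, -181008, 2505492, 113709501, -392497704, -22267975842, 15813018612, 1006687061955,
  4790335807440, 11411139731340, 17123160405860, 17539414137885, 11380874596680, 2550902968690,
  -2666979120060, -3045579324885, -1031038013280, 727242623640, 500569244220, 41745028895,
  -77382913560, -138366520350, 93266960860, -13492483695, -2869423920, 758378028, 33405516,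
  -12597369, -525832, 24078, -276]

/-- Coefficients of the denominator of the covering `x ↦ t` defining `fTilde`. -/
def coverDen : List ℤ :=
  [0, 16, 864, 20792, 293032, 2669825, 16338340, 67221810, 178230880, 262016455, 64127400,
  -429300110, -535946540, 143964155, 573131080, 57602300, -314293280, -39342070, 103441840,
  1903540, -19972400, 2668155, 1847220, -594990, -6240, 33575, -7512, 802, -44, 1]

/-- Lower coefficients of the numerator of the dual covering. -/
def dualNum : List ℤ :=
  [-2134679257557320832, -46607163790001504832, -259304233147171222176, 415666194505131458736,
  4344603213728442628008, -5012135664096278929068, -10275834883421230313166,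
  3467916947927332909305, 11375346239760767568120, 6021040681256913280260, 845411254435676485620,
  -254917350149674668390, -121298769106851432960, -17389482743429394840, 3754416121433937630,
  1636839263906029215, 49786585432029360, -32486220785116440, -11119944533911560,
  -217189878555780, 495349409554920, -23715752111100, 6356232086670, -2725796249145, 208883418840,
  10431633492, -1022228748, -30708774, 638064, 9792, -222]

/-- Coefficients of the denominator of the dual covering. -/
def dualDen : List ℤ :=
  [0, -1853020188851841, -22236242266222092, -117540959633589618, -357274493366610924,
  -680563393319853675, -820774124558163720, -579602382916124340, -151640114128113960,
  93945004422298695, 82704547277444700, 8251910104678290, -11654705426549220, -2907053565467355,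
  929154027306960, 282516740044200, -56419037846640, -13031884369755, 2638844566380, 236645508690,
  -68294445300, -309752505, 879501240, -41161140, -4690920, 466325, -1084, -1458, 68, -1]

/-- The factor of the correspondence between the two coverings that expresses incidence. -/
def incidence : List (List ℤ) :=
  [[0, 793437161472, 4760622968832, 9124527356928, 1983592903680, -12645404760960,
   -10116323808768, 5256521194752, 7140934453248, -247949112960, -1983592903680, -297538935552,
   198359290368, 49589822592],
   [223154201664, 5940447498000, 13928369233644, -69320932863165, -364058516952648,
   -641078888566230, -476758792828980, -51280310372391, 106931498701680, 15703960381452,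
   -24699691949148, -908931513915, 918444839256, 251823317850, 9814652388, -43046721],
   [297538935552, 1837578426048, -112055780369520, -821241574258428, -2296889694108144,
   -3094983812478870, -1837131735007152, 103980885125580, 728808000738912, 212604330413196,
   -127053334493424, -13422216322188, 5923611447120, 77493663738, 47523579984, -248714388],
   [71629743744, -7254042104160, -199551321034056, -942283650992130, -1583419907551428,
   -803855533493205, -77737882135140, -701570370841866, -348257304993960, 377554202867322,
   21240905985792, -29541279954330, -3218026184244, 1634986208115, -32339247732, -545258466],
   [-55099802880, -6676973705664, -113266819617264, -277338705126876, 349587168780600,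
   1665452142855720, 1054138731723216, -852794692260804, -552902535252216, 269439625682280,
   5210547532920, -9437643654876, 99529215264, -70925879664, 16035346440, -544431780],
   [-23978617920, -1748270828880, -19659961835820, 29819310694605, 374119280140140,
   629589383923500, 148299374225520, -200188362962745, 66482791984080, 38314559334240,
   -44697302344260, 7061161793355, 2708950426020, -732055253580, 21437148960, -218448495],
   [2993075712, 133318470240, 2940161719392, 2770188306840, -50261250032784, -162602654741190,
   -132591909911400, 70793972893512, 78353944245000, -33497030074284, 400673639016, 420073098840,
   189943976808, -8245711710, -779901696, -6700968],
   [2235568896, 114540608304, 1287213787440, -7005604587444, -41391907131312, -49497408439335,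
   9014723440704, 22794494880240, -16905640677624, -5554173943242, 7499089674648, -1649992980024,
   -133677575640, 59201857449, -943903368, 6301476],
   [14556672, 7034791680, 152328006432, 742539133800, 4174302005136, 11479863620160,
   9066926730240, -4826570134248, -3680864486640, 2856446325936, -907878649104, 158750101800,
   1631739168, -5542985520, 34187184, 375192],
   [-82451520, -2700652752, -8368545132, 434350641357, 1498088954160, 578092270410,
   -2039361109812, -760768476777, 1339260605712, 9091107900, -333493700580, 113575117707,
   -10024570368, -296422902, 19072260, -72495],
   [-6324480, -405374976, -8293774896, -57798441324, -217790538480, -330147638370, 3691587744,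
   288038170044, -66432392784, -119360902860, 86756637600, -25383863484, 3034120896, -37878786,
   -671760, -3780],
   [964224, 31527360, 189092664, -3057973650, -965027268, 30742686045, 29914741980, -31638216546,
   -12695768280, 20823449382, -7843499568, 1421416350, -167221764, 8870085, -255492, 414],
   [145152, 4045248, 58787280, 388070772, 795755256, -251818920, -1250807952, 1161646380,
   1033115112, -1341194904, 373383576, 5922612, -9991680, 408288, -7416, 12],
   [5184, 136080, 1569324, 20444355, 2114092, -127662080, -110213000, 39691689, 10590000,
   15648792, -9419388, -219195, 495876, -16120, 248, -1],
   [0, 2016, 12096, -401456, 709040, 4287870, 3408696, -331344, -867096, 16620, 105960, -7056,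
   -7096, 166],
   [0, -16, -416, -4184, -20040, -44545, -35896, -5476, 4856, 1130, -360, -44, 16, -1]]

/-- The factor of the correspondence between the two coverings that expresses non-incidence. -/
def coincidence : List (List ℤ) :=
  [[43046721, 2066242608, 43046721000, 506229438960, 3646057268700, 16184878348464,
   41262520507992, 45302369180400, -17601373749690, -45302369180400, 41262520507992,
   -16184878348464, 3646057268700, -506229438960, 43046721000, -2066242608, 43046721],
   [459165024, 13813214472, 370440949050, 10375981629840, 106297181352900, 33879988724616,
   133114150189278, 461296314986400, -185239797719760, -104158715913000, 148830412366998,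
   -116476315110576, 53055083632500, -12360913764840, 1238071525650, -22039921152, 267846264],
   [2104506360, -30993639120, -2077171692165, 12716968606020, 603530647470990, 1183248667303920,
   -129598315628895, -452763466403940, 914295039692220, 257447579210640, -354249363384675,
   -171026950244580, 212341604051790, -66487903265520, 7924707360135, -191350646460, 637729200],
   [5356925280, -156860125560, -15559231991040, -208739391256080, -90484534673460,
   1296132069009600, 2048537395993320, 941165148967560, -2286443414880, -332306067949560,
   -93056467012560, -76099743596160, 199905810840540, -83524579027920, 11687452833960,
   -206404598520, 677882520],
   [8109789660, 931357438380, 12707396369460, -32625660182580, -107003899697535, 722882990145420,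
   2638189847339280, 2395379735913060, -578159941109130, -1096734185857260, 288976362096600,
   111029388683220, 28945441000665, -41492355933420, 7903000455660, -19742442660, 209295900],
   [7102886112, 179258434776, 9446611846410, 99637852127040, 280951391994840, 544944737840688,
   1259633849483934, 1507502275261560, 12696224167440, -764389051482960, 57238452775854,
   155463649724952, -37160988917760, -7478697830040, 2906290368810, 53698968144, -160315848],
   [2933081928, -54778010616, -1940829920415, 25120332522000, 141192320114340, 274633529349132,
   341302408636851, 351062205175260, 103448299581000, -205175001247560, -81042448744089,
   64184974326288, -11244589051860, 506876980500, 395938536885, 14312197476, -105477552],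
   [-122821920, 30937175640, -177489736920, -6727266986040, -14342568432480, 4491627435360,
   8498738492640, -29524133517120, -21901577383440, -13762784429280, -24016622536800,
   5162496780960, 3226343668920, 297729500040, -168994748520, -5676081480, 15989400],
   [-427842810, -5357338380, 233755423830, -1794645528840, -13014666722205, -29036241898200,
   -37557952966890, -37934696224620, -20361080912490, 5308316290620, 5021777676870,
   -1959965932680, 1237263027795, -26919083160, -70495318170, -1980827460, 16840710],
   [13646880, -873857160, -66123181170, 156762218160, 789999956820, -751598042040, -4544255231910,
   -5589094947120, -2761742496240, 1654752422520, 2438842158450, -129364158240, -161585321580,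
   -29100791160, 2126819430, 337914720, -1776600],
   [36210888, 291721824, 2543999805, 85223313540, 557508607470, 1448587841832, 1816750401831,
   1194065568180, 426936614940, 64358889120, 71145292491, 39099095388, -59282139330, -2944400040,
   2921075505, 130825836, -1302192],
   [-9743328, -85557384, 977071680, -8596703520, -61830403380, -104340191712, 8883092664,
   199165358280, 193095017280, 4184178120, -70162511616, -7056625248, 4143758220, 924023520,
   -33249720, -15580296, 219912],
   [1236060, 28504980, 130035960, 424105020, -1413245385, -13102299780, -30356754620,
   -26518593940, -2407365030, 5977096140, -1409166900, -1886608380, 683522415, 127102980,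
   -30492240, -4186060, 31900],
   [-90720, -4489560, -61030290, -241030080, -277134960, 429665600, 1292254570, 483009560,
   -1176668880, -907618560, 149751690, 132846840, 18626040, -13198920, -2088290, 614480, -11480],
   [3960, 290280, 5227335, 28106920, 84043840, 176598620, 243268005, 145759060, -53670880,
   -83702760, 10447825, 18790520, -3775960, -855420, 178035, 8940, 1200],
   [-96, -5208, -92840, -382040, -504760, 166016, 930368, 517360, -591440, -715760, 290288,
   378624, -195360, -15960, 21560, -2872, -56],
   [1, 28, 310, 1680, 4265, 2464, -8418, -9940, 8980, 9940, -8418, -2464, 4265, -1680, 310, -28,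
   1]]

/-- Labels for the roots of the specialization at `2077` modulo `4759`. -/
def pointTable : List ℤ :=
  [0, 50, 155, 4670, 358, 818, 1762, 3670, 362, 765, 3905, 1889, 1648, 1659, 3807, 3321, 536,
  3780, 3339, 2743, 4630, 2512, 3588, 4085, 1951, 937, 4724, 3078, 3418, 1926, 4215, 2119]

/-- Labels for the roots of the dual specialization at `2077` modulo `4759`. -/
def hyperplaneTable : List ℤ :=
  [0, 3960, 922, 1998, 4526, 1558, 3362, 2679, 2206, 542, 4239, 4464, 4623, 3511, 3957, 3185,
  2765, 498, 4049, 1140, 4620, 789, 2251, 205, 1578, 773, 1486, 4682, 46, 308, 4616, 828]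

/-- Bézout coefficient for the specialization at `287` modulo `653`. -/
def bezoutLeft653 : List ℤ :=
  [309, 174, 359, 554, 296, 583, 508, 69, 457, 209, 317, 395, 534, 238, 450, 95, 103, 49, 122,
  423, 46, 314, 323, 623, 473, 48, 405, 532, 93, 83]

/-- Bézout coefficient for the derivative of the specialization at `287` modulo `653`. -/
def bezoutRight653 : List ℤ :=
  [335, 19, 200, 371, 289, 342, 634, 70, 324, 604, 199, 9, 645, 449, 578, 200, 403, 319, 114, 268,
  23, 392, 3, 568, 14, 473, 129, 303, 398, 453, 545]

/-- Bézout coefficient for the specialization at `1` modulo `17`. -/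
def bezoutLeft17 : List ℤ :=
  [8, 5, 2, 16, 3, 14, 7, 10, 14, 0, 3, 11, 8, 5, 3, 16, 7, 7, 4, 9, 14, 4, 15, 9, 13, 4, 10, 5,
  4, 16]

/-- Bézout coefficient for the derivative of the specialization at `1` modulo `17`. -/
def bezoutRight17 : List ℤ :=
  [3, 4, 8, 12, 16, 16, 15, 3, 15, 4, 0, 15, 8, 12, 8, 3, 1, 10, 2, 3, 16, 8, 14, 7, 12, 6, 4, 4,
  11, 16, 11]

/-- Bézout coefficient for the specialization at `1` modulo `7`. -/
def bezoutLeft7 : List ℤ :=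
  [0, 5, 0, 3, 0, 6, 4, 2, 3, 3, 4, 5, 3, 5, 3, 5, 1, 5, 6, 0, 4, 4, 5, 3, 4, 1, 3, 3, 2, 3]

/-- Bézout coefficient for the derivative of the specialization at `1` modulo `7`. -/
def bezoutRight7 : List ℤ :=
  [5, 2, 4, 6, 2, 0, 5, 5, 0, 4, 4, 1, 4, 3, 4, 1, 3, 2, 2, 5, 3, 5, 1, 2, 4, 4, 1, 4, 6, 5, 6]

/-- Powers of `x ^ 17` modulo the specialization at `1` and `17`, with quotients. -/
def frobeniusRows17 : List (List ℤ × List ℤ) :=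
  [([0, 0, 0, 0, 0, 0, 0, 0, 0, 0, 0, 0, 0, 0, 0, 0, 0, 1], []),
   ([15, 5, 14, 16, 13, 14, 15, 2, 16, 15, 5, 7, 8, 10, 12, 12, 9, 9, 15, 11, 11, 1, 16, 7, 13,
   12, 3, 9, 16, 8, 16], [2, 11, 4, 1]),
   ([12, 2, 2, 12, 1, 2, 0, 11, 8, 13, 14, 13, 16, 9, 6, 1, 1, 6, 16, 4, 4, 9, 11, 8, 5, 3, 15, 2,
   7, 14, 9], [5, 4, 8, 4, 16, 16, 2, 15, 6, 15, 6, 7, 11, 6, 3, 4, 16]),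
   ([14, 11, 10, 7, 8, 10, 11, 3, 5, 13, 0, 6, 9, 1, 13, 6, 8, 15, 16, 6, 11, 9, 3, 0, 7, 0, 5, 8,
   16, 2, 4], [3, 13, 6, 5, 4, 15, 11, 14, 12, 9, 7, 2, 0, 15, 9, 16, 9]),
   ([9, 14, 13, 13, 14, 10, 4, 13, 9, 12, 4, 5, 5, 6, 16, 10, 11, 6, 7, 8, 15, 16, 16, 4, 7, 3,
   11, 16, 15, 14, 4], [8, 16, 5, 12, 16, 9, 10, 4, 7, 5, 14, 1, 9, 0, 0, 1, 4]),
   ([5, 12, 5, 2, 12, 3, 0, 7, 2, 0, 6, 7, 4, 2, 8, 3, 6, 8, 2, 2, 4, 3, 8, 3, 6, 6, 5, 5, 10, 2,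
   5], [12, 16, 9, 13, 16, 1, 4, 6, 1, 10, 4, 0, 9, 0, 13, 13, 4]),
   ([2, 7, 3, 14, 2, 11, 6, 5, 10, 7, 12, 8, 10, 1, 8, 12, 9, 2, 13, 1, 13, 0, 3, 15, 5, 1, 4, 16,
   11, 12, 10], [15, 11, 2, 12, 5, 8, 4, 5, 6, 4, 6, 0, 15, 9, 5, 5, 5]),
   ([10, 13, 7, 13, 11, 12, 16, 15, 8, 2, 13, 4, 5, 14, 16, 10, 0, 16, 1, 15, 13, 15, 0, 6, 15,
   11, 7, 11, 8, 1, 3], [7, 9, 7, 3, 3, 5, 6, 8, 4, 8, 16, 5, 16, 8, 16, 1, 10]),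
   ([7, 14, 16, 6, 15, 0, 9, 3, 6, 8, 16, 4, 16, 11, 10, 5, 14, 2, 8, 5, 8, 0, 3, 4, 12, 16, 10,
   14, 8, 15, 3], [10, 15, 9, 14, 9, 11, 8, 3, 5, 5, 10, 0, 2, 9, 11, 13, 3]),
   ([2, 0, 7, 6, 1, 15, 12, 12, 4, 13, 11, 2, 7, 6, 1, 16, 9, 14, 15, 8, 6, 6, 0, 5, 1, 16, 8, 5,
   11, 2, 1], [15, 1, 3, 4, 12, 13, 1, 6, 2, 6, 3, 2, 11, 13, 16, 10, 3]),
   ([11, 16, 3, 14, 3, 13, 4, 8, 13, 6, 0, 3, 10, 16, 7, 6, 5, 7, 10, 16, 6, 14, 2, 1, 15, 14, 5,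
   12, 10, 11, 9], [6, 15, 9, 14, 10, 12, 9, 2, 12, 14, 10, 8, 16, 5, 13, 6, 1]),
   ([4, 4, 4, 2, 15, 14, 10, 5, 7, 8, 6, 16, 5, 9, 7, 3, 12, 12, 10, 0, 15, 5, 1, 16, 13, 16, 9,
   3, 10, 2, 1], [13, 15, 1, 16, 3, 1, 13, 9, 12, 0, 7, 7, 6, 4, 0, 13, 9]),
   ([2, 0, 4, 5, 2, 7, 12, 15, 10, 0, 13, 1, 7, 10, 9, 13, 15, 15, 14, 6, 7, 3, 8, 8, 1, 6, 10, 7,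
   14, 9, 12], [15, 1, 6, 12, 4, 11, 15, 6, 7, 5, 13, 5, 15, 16, 12, 6, 1]),
   ([14, 7, 0, 5, 11, 12, 6, 1, 15, 11, 14, 12, 5, 15, 9, 3, 4, 8, 10, 9, 5, 13, 9, 4, 6, 9, 15,
   10, 14, 6], [3, 0, 14, 16, 5, 5, 14, 5, 3, 8, 3, 3, 11, 16, 12, 6, 12]),
   ([5, 0, 2, 6, 7, 3, 9, 5, 3, 2, 15, 9, 13, 15, 11, 7, 13, 3, 15, 12, 0, 0, 12, 1, 12, 1, 8, 6,
   13, 3, 15], [12, 11, 6, 7, 3, 10, 2, 13, 8, 0, 16, 14, 0, 13, 4, 6]),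
   ([2, 5, 15, 13, 11, 16, 8, 7, 1, 16, 11, 9, 0, 13, 12, 14, 6, 16, 13, 12, 5, 14, 15, 14, 15, 9,
   16, 10, 1, 9, 10], [15, 13, 6, 9, 15, 7, 15, 8, 14, 0, 7, 12, 13, 2, 3, 12, 15]),
   ([3, 14, 7, 0, 9, 3, 14, 1, 1, 14, 7, 7, 0, 10, 3, 13, 2, 9, 12, 9, 3, 2, 15, 3, 5, 5, 1, 2, 8,
   6], [14, 13, 15, 11, 0, 9, 7, 8, 3, 14, 6, 12, 7, 14, 11, 15, 10]),
   ([16, 1, 11, 7, 1, 10, 10, 9, 16, 0, 14, 7, 0, 4, 4, 9, 0, 4, 14, 7, 9, 10, 16, 11, 6, 3, 7, 8,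
   0, 7, 15], [1, 7, 10, 13, 1, 4, 2, 3, 6, 9, 5, 7, 7, 15, 15, 6]),
   ([6, 12, 3, 1, 13, 16, 10, 14, 8, 7, 10, 1, 4, 15, 15, 7, 12, 15, 11, 1, 13, 3, 13, 10, 5, 0,
   0, 13, 10, 10], [11, 8, 16, 12, 9, 9, 2, 13, 7, 15, 14, 2, 4, 13, 6, 16, 15]),
   ([11, 6, 2, 3, 7, 9, 16, 0, 16, 11, 2, 11, 2, 3, 8, 15, 12, 0, 7, 1, 9, 5, 5, 13, 13, 11, 14,
   13, 5, 10, 7], [6, 8, 5, 0, 14, 4, 16, 10, 12, 2, 10, 0, 12, 10, 16, 10]),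
   ([3, 10, 16, 9, 12, 0, 3, 16, 14, 6, 0, 12, 9, 8, 10, 3, 13, 15, 13, 6, 6, 2, 7, 7, 10, 10, 14,
   0, 6, 1, 1], [14, 0, 4, 12, 8, 6, 3, 8, 4, 4, 4, 0, 15, 4, 3, 4, 7]),
   ([14, 3, 14, 15, 6, 3, 8, 11, 1, 5, 0, 5, 3, 3, 7, 6, 0, 3, 15, 4, 8, 11, 11, 10, 11, 8, 2, 6,
   16, 14, 14], [3, 4, 15, 10, 4, 4, 1, 6, 16, 14, 1, 13, 13, 3, 4, 5, 1]),
   ([1, 6, 16, 14, 1, 13, 9, 12, 11, 1, 2, 13, 5, 13, 1, 8, 11, 3, 8, 11, 16, 2, 4, 10, 16, 7, 12,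
   12, 5, 15, 5], [16, 3, 9, 6, 8, 7, 2, 9, 3, 7, 6, 3, 12, 14, 5, 2, 14]),
   ([3, 9, 7, 1, 14, 8, 8, 0, 10, 16, 11, 9, 4, 15, 0, 15, 12, 12, 5, 13, 0, 6, 10, 12, 10, 13,
   10, 15, 3, 9, 14], [14, 1, 4, 2, 9, 6, 7, 8, 5, 3, 15, 15, 4, 3, 1, 1, 5]),
   ([4, 13, 2, 12, 0, 2, 0, 2, 11, 3, 13, 5, 5, 0, 0, 12, 8, 14, 8, 0, 13, 16, 3, 10, 10, 11, 13,
   13, 9, 3, 10], [13, 6, 16, 16, 4, 13, 7, 9, 2, 0, 5, 16, 5, 1, 6, 14, 14]),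
   ([4, 6, 5, 0, 8, 0, 7, 3, 9, 16, 12, 6, 10, 5, 6, 3, 16, 5, 7, 14, 5, 14, 3, 16, 11, 0, 6, 2,
   15, 7, 14], [13, 13, 1, 3, 12, 1, 2, 4, 12, 0, 1, 6, 7, 0, 12, 9, 10]),
   ([8, 4, 15, 4, 3, 9, 8, 15, 11, 9, 0, 9, 4, 4, 8, 6, 15, 1, 12, 16, 10, 12, 14, 13, 3, 5, 2, 5,
   2, 4, 5], [9, 0, 10, 7, 4, 8, 1, 9, 6, 14, 0, 6, 9, 14, 10, 12, 14]),
   ([9, 8, 15, 0, 10, 6, 12, 6, 10, 11, 7, 4, 11, 7, 2, 12, 1, 2, 16, 6, 14, 8, 13, 13, 4, 5, 14,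
   0, 3, 4, 10], [8, 5, 0, 13, 4, 2, 14, 3, 8, 10, 16, 3, 13, 16, 5, 7, 5]),
   ([6, 7, 10, 7, 9, 1, 0, 15, 15, 11, 12, 10, 12, 6, 6, 6, 6, 3, 14, 6, 13, 11, 7, 7, 13, 16, 6,
   0, 11, 4, 2], [11, 13, 15, 10, 5, 14, 3, 3, 10, 9, 0, 1, 11, 8, 10, 10, 10]),
   ([1, 3, 13, 5, 16, 12, 15, 5, 11, 14, 1, 10, 9, 15, 3, 8, 4, 14, 13, 4, 12, 15, 9, 13, 10, 2,
   10, 9, 11, 9, 10], [16, 6, 2, 7, 2, 11, 4, 2, 11, 9, 1, 15, 14, 7, 15, 12, 2])]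

/-- Iterated Frobenius images of `x` modulo the specialization at `1` and `17`. -/
def frobeniusChain17 : List (List ℤ) :=
  [[0, 0, 0, 0, 0, 0, 0, 0, 0, 0, 0, 0, 0, 0, 0, 0, 0, 1],
   [3, 14, 7, 0, 9, 3, 14, 1, 1, 14, 7, 7, 0, 10, 3, 13, 2, 9, 12, 9, 3, 2, 15, 3, 5, 5, 1, 2, 8,
   6],
   [8, 5, 13, 8, 13, 7, 15, 11, 13, 8, 11, 10, 7, 16, 9, 4, 0, 7, 14, 8, 7, 9, 13, 13, 6, 7, 4,
   15, 2, 11, 11],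
   [11, 2, 0, 15, 11, 13, 4, 15, 5, 4, 2, 4, 9, 15, 0, 10, 9, 9, 3, 7, 9, 6, 14, 5, 14, 2, 16, 2,
   8, 9, 16],
   [0, 1]]

/-- Powers of `x ^ 7` modulo the specialization at `1` and `7`, with quotients. -/
def frobeniusRows7 : List (List ℤ × List ℤ) :=
  [([0, 0, 0, 0, 0, 0, 0, 1], []),
   ([0, 0, 0, 0, 0, 0, 0, 0, 0, 0, 0, 0, 0, 0, 1], []),
   ([0, 0, 0, 0, 0, 0, 0, 0, 0, 0, 0, 0, 0, 0, 0, 0, 0, 0, 0, 0, 0, 1], []),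
   ([0, 0, 0, 0, 0, 0, 0, 0, 0, 0, 0, 0, 0, 0, 0, 0, 0, 0, 0, 0, 0, 0, 0, 0, 0, 0, 0, 0, 1], []),
   ([2, 2, 6, 0, 3, 1, 6, 6, 1, 5, 6, 1, 6, 5, 6, 1, 4, 6, 1, 6, 5, 3, 1, 2, 3, 0, 6, 0, 4, 2],
   [4, 0, 5, 3, 1]),
   ([0, 6, 5, 3, 4, 4, 2, 4, 6, 3, 0, 2, 2, 5, 2, 5, 1, 3, 1, 6, 1, 1, 2, 0, 5, 2, 6, 0, 1, 1, 1],
   [0, 5, 5, 1, 3, 2]),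
   ([6, 4, 2, 3, 5, 0, 2, 1, 4, 0, 1, 0, 0, 1, 4, 3, 3, 4, 5, 4, 3, 4, 5, 5, 3, 3, 6, 2, 1, 2, 2],
   [5, 3, 1, 1, 2, 4, 1]),
   ([4, 6, 4, 5, 0, 3, 5, 4, 1, 6, 3, 5, 4, 2, 1, 1, 2, 1, 5, 3, 5, 4, 5, 4, 2, 0, 2, 3, 0, 5, 5],
   [1, 4, 4, 1, 3, 1, 2]),
   ([4, 0, 1, 4, 2, 1, 2, 2, 1, 2, 5, 6, 3, 5, 3, 1, 1, 4, 6, 6, 0, 4, 1, 6, 1, 3, 0, 4, 0, 5, 5],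
   [1, 6, 3, 0, 5, 6, 5]),
   ([3, 0, 6, 0, 0, 3, 1, 3, 3, 6, 0, 4, 6, 0, 0, 6, 5, 0, 6, 0, 2, 5, 3, 1, 3, 3, 5, 4, 5, 3, 2],
   [6, 1, 4, 1, 5, 6, 5]),
   ([6, 3, 1, 2, 3, 6, 6, 0, 0, 2, 6, 0, 1, 6, 4, 0, 1, 4, 3, 6, 2, 6, 6, 1, 6, 6, 1, 1, 2, 1, 4],
   [5, 1, 1, 6, 3, 2, 2]),
   ([5, 0, 3, 4, 3, 2, 0, 5, 5, 5, 2, 4, 0, 6, 0, 1, 4, 3, 0, 0, 2, 6, 2, 1, 0, 0, 5, 4, 6, 0, 4],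
   [3, 4, 2, 5, 4, 6, 4]),
   ([4, 4, 0, 3, 5, 2, 5, 1, 3, 1, 1, 5, 3, 6, 2, 3, 0, 2, 3, 3, 6, 1, 3, 1, 2, 6, 1, 0, 0, 3, 1],
   [1, 0, 0, 1, 5, 5, 4]),
   ([3, 3, 6, 4, 2, 1, 4, 5, 5, 6, 0, 5, 3, 5, 4, 6, 6, 2, 1, 4, 3, 1, 0, 2, 2, 6, 2, 3, 1, 4, 4],
   [6, 0, 5, 1, 0, 6, 1]),
   ([0, 4, 6, 1, 4, 5, 3, 3, 6, 5, 1, 1, 3, 6, 6, 0, 3, 2, 0, 0, 4, 2, 6, 2, 0, 0, 0, 4, 5], [0,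
   1, 4, 5, 5, 2, 4]),
   ([3, 6, 4, 1, 4, 5, 4, 4, 4, 0, 1, 6, 6, 3, 4, 2, 5, 3, 4, 2, 4, 2, 4, 5, 1, 6, 6, 5, 3, 3, 4],
   [6, 6, 2, 5, 5]),
   ([3, 2, 4, 3, 6, 2, 5, 1, 2, 3, 5, 4, 0, 0, 6, 3, 6, 1, 5, 4, 4, 1, 2, 4, 0, 6, 4, 0, 5, 0, 6],
   [6, 5, 3, 1, 4, 1, 4]),
   ([0, 2, 4, 6, 0, 6, 0, 2, 3, 3, 5, 1, 4, 4, 2, 1, 1, 4, 5, 0, 1, 3, 2, 5, 5, 6, 0, 0, 5, 2, 3],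
   [0, 4, 4, 1, 0, 4, 6]),
   ([0, 0, 1, 3, 1, 6, 0, 2, 6, 1, 1, 4, 0, 2, 4, 6, 4, 3, 3, 2, 4, 4, 5, 1, 0, 1, 5, 2, 5, 5],
   [0, 0, 2, 4, 5, 4, 3]),
   ([3, 5, 6, 5, 4, 5, 5, 0, 6, 6, 3, 5, 2, 4, 5, 5, 0, 1, 1, 4, 6, 0, 3, 6, 6, 4, 2, 5, 3, 2, 3],
   [6, 4, 1, 0, 6, 5]),
   ([2, 6, 5, 2, 3, 2, 4, 5, 2, 6, 0, 0, 3, 3, 0, 3, 1, 0, 3, 5, 2, 5, 5, 6, 6, 6, 1, 3, 2, 4],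
   [4, 1, 2, 3, 3, 4, 3]),
   ([1, 0, 2, 5, 3, 0, 1, 5, 2, 2, 2, 1, 3, 2, 6, 1, 3, 4, 6, 5, 2, 6, 3, 1, 1, 3, 6, 0, 6, 5, 4],
   [2, 5, 6, 1, 0, 4]),
   ([1, 4, 1, 0, 5, 4, 4, 0, 5, 6, 3, 5, 3, 6, 3, 3, 4, 6, 0, 5, 0, 2, 5, 1, 4, 6, 6, 5, 6, 6, 6],
   [2, 6, 3, 1, 6, 3, 4]),
   ([2, 0, 4, 4, 6, 0, 4, 2, 5, 2, 4, 1, 4, 0, 5, 0, 4, 0, 5, 6, 0, 1, 4, 4, 6, 1, 3, 0, 1, 5, 2],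
   [4, 3, 5, 4, 5, 3, 6]),
   ([2, 3, 2, 4, 5, 5, 0, 4, 0, 6, 4, 6, 6, 3, 5, 4, 6, 0, 0, 1, 5, 3, 0, 5, 0, 1, 2, 4, 3, 4, 1],
   [4, 2, 2, 0, 5, 4, 2]),
   ([3, 0, 3, 6, 6, 3, 1, 3, 0, 6, 4, 6, 6, 0, 4, 1, 3, 3, 6, 4, 0, 0, 5, 2, 0, 2, 6, 2, 3, 1, 2],
   [6, 1, 5, 5, 6, 0, 1]),
   ([5, 1, 3, 5, 2, 4, 3, 6, 4, 3, 0, 2, 4, 2, 3, 6, 4, 4, 1, 3, 3, 6, 1, 0, 0, 3, 1, 4, 3, 4],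
   [3, 6, 0, 2, 2, 0, 2]),
   ([6, 6, 0, 1, 6, 5, 1, 6, 3, 1, 5, 4, 4, 3, 4, 1, 0, 3, 0, 1, 3, 4, 5, 0, 5, 3, 6, 6, 3, 4, 4],
   [5, 0, 0, 5, 1, 4]),
   ([4, 6, 5, 2, 5, 0, 1, 0, 2, 2, 6, 3, 3, 0, 4, 2, 3, 5, 6, 3, 3, 4, 5, 4, 1, 3, 5, 4, 4, 1, 4],
   [1, 4, 6, 0, 0, 2, 4]),
   ([5, 5, 2, 6, 2, 0, 0, 0, 0, 3, 0, 1, 1, 5, 4, 1, 0, 0, 1, 5, 3, 6, 0, 3, 5, 6, 1, 0, 3, 6, 3],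
   [3, 0, 4, 0, 6, 6, 4])]

/-- Iterated Frobenius images of `x` modulo the specialization at `1` and `7`. -/
def frobeniusChain7 : List (List ℤ) :=
  [[0, 0, 0, 0, 0, 0, 0, 1],
   [6, 4, 2, 3, 5, 0, 2, 1, 4, 0, 1, 0, 0, 1, 4, 3, 3, 4, 5, 4, 3, 4, 5, 5, 3, 3, 6, 2, 1, 2, 2],
   [5, 6, 6, 5, 4, 0, 4, 6, 4, 0, 0, 5, 5, 1, 0, 6, 2, 6, 4, 3, 3, 1, 0, 6, 3, 4, 4, 2, 5, 4, 3],
   [2, 2, 3, 0, 4, 4, 2, 1, 3, 4, 2, 1, 5, 2, 1, 3, 4, 3, 3, 5, 5, 2, 2, 4, 0, 5, 2, 5, 2, 1, 3],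
   [0, 0, 1, 1, 5, 2, 4, 1, 3, 4, 0, 6, 5, 3, 2, 4, 4, 4, 0, 3, 6, 1, 2, 6, 4, 3, 6, 2, 6, 4, 4],
   [3, 5, 1, 5, 2, 5, 5, 2, 0, 3, 2, 6, 6, 3, 6, 1, 3, 5, 0, 5, 5, 5, 1, 0, 4, 4, 3, 3, 0, 3],
   [3, 6, 4, 2, 6, 6, 6, 5, 0, 4, 1, 4, 5, 1, 4, 6, 4, 5, 3, 5, 5, 1, 5, 0, 4, 0, 0, 5, 3, 6, 5],
   [5, 2, 5, 5, 5, 2, 0, 3, 6, 5, 5, 5, 0, 4, 1, 1, 4, 5, 2, 3, 5, 0, 1, 3, 3, 3, 3, 0, 1, 6, 2],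
   [4, 2, 6, 6, 5, 0, 4, 0, 1, 1, 0, 4, 6, 0, 2, 3, 6, 3, 4, 2, 0, 0, 3, 3, 1, 2, 4, 1, 2, 0, 6],
   [2, 3, 0, 0, 2, 4, 4, 6, 6, 4, 3, 5, 1, 4, 1, 3, 1, 2, 1, 0, 5, 6, 0, 0, 5, 0, 5, 1, 5, 6, 2],
   [6, 1, 2, 5, 4, 0, 5, 2, 3, 2, 1, 3, 2, 2, 1, 3, 6, 3, 1, 5, 2, 1, 2, 6, 6, 5, 6, 2, 6, 5, 5],
   [2, 0, 2, 6, 3, 6, 5, 3, 3, 6, 4, 4, 2, 1, 5, 4, 0, 2, 5, 4, 2, 4, 0, 0, 0, 1, 6, 6, 1, 6],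
   [2, 1, 4, 3, 1, 5, 1, 2, 2, 1, 1, 2, 6, 6, 0, 0, 3, 5, 1, 3, 6, 1, 5, 1, 2, 1, 6, 2, 4, 5, 1],
   [0, 4, 2, 6, 5, 2, 4, 0, 6, 5, 2, 0, 4, 1, 0, 6, 0, 4, 0, 6, 6, 3, 2, 6, 5, 0, 6, 3, 5, 6, 2],
   [5, 6, 5, 4, 0, 1, 2, 4, 6, 6, 3, 0, 0, 4, 5, 6, 5, 6, 3, 3, 3, 1, 5, 6, 6, 3, 3, 0, 0, 1],
   [2, 5, 0, 6, 3, 6, 2, 0, 1, 4, 2, 4, 3, 4, 2, 6, 3, 0, 1, 6, 1, 2, 1, 3, 5, 5, 6, 6, 2, 0, 3],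
   [6, 3, 4, 2, 4, 0, 6, 6, 4, 3, 5, 1, 5, 4, 4, 2, 6, 0, 4, 6, 6, 1, 6, 1, 2, 3, 0, 5, 5, 6, 1],
   [3, 5, 3, 4, 6, 5, 2, 0, 6, 5, 5, 5, 5, 1, 5, 0, 4, 5, 2, 4, 5, 0, 2, 1, 5, 0, 6, 4, 5, 6],
   [6, 5, 4, 0, 6, 0, 3, 2, 0, 5, 4, 5, 0, 6, 3, 3, 3, 6, 0, 2, 3, 5, 0, 2, 0, 5, 5, 0, 6, 0, 2],
   [1, 6, 5, 2, 4, 0, 5, 0, 4, 6, 4, 2, 0, 5, 4, 2, 1, 3, 5, 0, 2, 0, 1, 3, 3, 5, 3, 2, 4, 1, 3],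
   [1, 3, 0, 4, 3, 1, 5, 1, 1, 4, 0, 3, 4, 3, 6, 3, 1, 3, 3, 2, 2, 3, 3, 0, 4, 4, 1, 5, 3, 4],
   [6, 2, 4, 5, 6, 0, 5, 2, 5, 3, 0, 4, 5, 3, 6, 0, 0, 5, 6, 5, 5, 5, 6, 2, 4, 5, 1, 2, 0, 4, 3],
   [1, 6, 6, 6, 0, 1, 2, 2, 0, 4, 2, 5, 1, 1, 0, 5, 2, 2, 0, 1, 2, 6, 4, 4, 2, 0, 5, 4, 4, 0, 6],
   [4, 1, 3, 5, 6, 5, 0, 4, 2, 3, 6, 3, 2, 1, 2, 3, 2, 6, 0, 1, 2, 4, 1, 5, 4, 3, 1, 6, 2, 5, 1],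
   [4, 6, 0, 1, 0, 2, 3, 6, 1, 2, 6, 6, 0, 1, 2, 0, 2, 3, 3, 6, 5, 6, 2, 1, 4, 5, 0, 5, 4, 0, 6],
   [3, 5, 3, 6, 3, 1, 4, 0, 2, 6, 2, 3, 4, 2, 6, 4, 1, 6, 2, 0, 4, 6, 4, 0, 0, 2, 2, 4, 5, 0, 4],
   [5, 3, 3, 2, 6, 6, 0, 4, 6, 2, 1, 4, 4, 3, 3, 5, 1, 5, 5, 0, 3, 3, 4, 3, 4, 0, 0, 3, 2, 4, 4],
   [0, 2, 1, 0, 0, 6, 3, 2, 5, 1, 4, 6, 6, 3, 5, 0, 5, 2, 1, 5, 6, 1, 4, 2, 2, 3, 0, 3, 4, 1, 2],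
   [4, 0, 1, 1, 3, 5, 1, 2, 4, 2, 2, 0, 0, 3, 5, 6, 6, 2, 0, 3, 3, 2, 4, 5, 4, 0, 2, 4, 3, 4, 6],
   [3, 3, 4, 3, 4, 2, 2, 2, 3, 3, 2, 2, 5, 4, 6, 3, 2, 0, 6, 6, 0, 3, 2, 6, 2, 3, 6, 4, 1, 1, 1],
   [0, 1]]

end Data

theorem incidence_mul_coincidence {R : Type*} [CommRing R] (x y : R) :
    ev₂ incidence x y * ev₂ coincidence x y =
      (x ^ 31 + ev coverNum x) * ev dualDen y - (y ^ 31 + ev dualNum y) * ev coverDen x := by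
  have h : (addL₂ (mulL₂ incidence coincidence)
      (addL₂ (mulL₂ (dualDen.map fun c ↦ [c]) [smulL (-1) (coverNum ++ [1])])
        (mulL₂ ((dualNum ++ [1]).map fun c ↦ [c]) [coverDen]))).all (zeroMod 0) = true := by
    decide +kernel
  have h1 := ev₂_eq_zero x y h
  simp only [ev₂_addL₂, ev₂_mulL₂, ev₂_singleton, ev₂_map_singleton, ev_smulL, ev_append,
    ev_cons, ev_nil] at h1
  have h2 : coverNum.length = 31 := rfl
  have h3 : dualNum.length = 31 := rfl
  rw [h2, h3] at h1
  push_cast at h1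
  linear_combination h1

theorem isRootTable_pointTable :
    IsRootTable 4759 (specialize coverNum coverDen 2077) pointTable := by
  decide +kernel

theorem isRootTable_hyperplaneTable :
    IsRootTable 4759 (specialize dualNum dualDen 2077) hyperplaneTable := by
  decide +kernel

theorem isIncidenceTable_pointTable_hyperplaneTable :
    IsIncidenceTable 4759 incidence coincidence pointTable hyperplaneTable := by
  decide +kernel

theorem sepCheck_bezout653 : sepCheck 653 (specialize coverNum coverDen 287) bezoutLeft653
    bezoutRight653 = true := by
  decide +kernel

theorem card_roots653 : ((Finset.range 653).filter fun c : ℕ ↦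
    evMod 653 (specialize coverNum coverDen 287) c % (653 : ℕ) = 0).card = 15 := by
  decide +kernel

theorem sepCheck_bezout17 : sepCheck 17 (specialize coverNum coverDen 1) bezoutLeft17
    bezoutRight17 = true := by
  decide +kernel

theorem checkRows_frobeniusRows17 :
    checkRows 17 (specialize coverNum coverDen 1) [1] frobeniusRows17 = true := by
  decide +kernel

theorem checkChain_frobeniusChain17 :
    checkChain 17 ([1] :: frobeniusRows17.map Prod.fst) [0, 1] frobeniusChain17 = true := by
  decide +kernel

theorem evMod_coverNum17 : evMod 17 (specialize coverNum coverDen 1) (13 : ℕ) % (17 : ℕ) = 0 := by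
  decide +kernel

theorem ev₂Mod_incidence17 : ∀ c < 17, ev₂Mod 17 incidence (13 : ℕ) (c : ℕ) % (17 : ℕ) ≠ 0 := by
  decide +kernel

theorem sepCheck_bezout7 : sepCheck 7 (specialize coverNum coverDen 1) bezoutLeft7
    bezoutRight7 = true := by
  decide +kernel

theorem checkRows_frobeniusRows7 :
    checkRows 7 (specialize coverNum coverDen 1) [1] frobeniusRows7 = true := by
  decide +kernel

theorem checkChain_frobeniusChain7 :
    checkChain 7 ([1] :: frobeniusRows7.map Prod.fst) [0, 1] frobeniusChain7 = true := by
  decide +kernel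

theorem evMod_coverNum7 :
    ∀ c < 7, evMod 7 (specialize coverNum coverDen 1) (c : ℕ) % (7 : ℕ) ≠ 0 := by
  decide +kernel

section GaloisGroup

theorem ev₂_incidence_mul_ev₂_coincidence {E : Type*} [Field E] [Algebra ℤ[X] E]
    (x : IntegralRoot E (pencil coverNum coverDen))
    (y : IntegralRoot E (pencil dualNum dualDen)) :
    ev₂ incidence x.1 y.1 * ev₂ coincidence x.1 y.1 = 0 := by
  have hx := x.2
  have hy := y.2
  rw [aeval_pencil] at hx hy
  rw [incidence_mul_coincidence]
  linear_combination ev dualDen y.1 * hx - ev coverDen x.1 * hy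

variable {K : Type*} {E : Type*} [Field K] [Field E] [Algebra K E] [Algebra ℤ[X] K]
  [Algebra ℤ[X] E] [IsScalarTower ℤ[X] K E] [FiniteDimensional K E] [IsGalois K E]
  [IsFractionRing ℤ[X] K] [FaithfulSMul ℤ[X] E]

variable (K) in
/-- The Galois group of a splitting field of both coverings surjects onto `SL₅(𝔽₂)`, with kernel
the elements fixing the roots of the first one. -/
theorem exists_surjective_specialLinearGroup
    (hs : ((pencil coverNum coverDen).map (algebraMap ℤ[X] E)).Splits)
    (hs' : ((pencil dualNum dualDen).map (algebraMap ℤ[X] E)).Splits) :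
    ∃ φ : (E ≃ₐ[K] E) →* Matrix.SpecialLinearGroup (Fin 5) (ZMod 2), Function.Surjective φ ∧
      ∀ σ, φ σ = 1 ↔ ∀ x : IntegralRoot E (pencil coverNum coverDen), σ • x = x := by
  have hl : coverNum.length = 31 := rfl
  have hl' : dualNum.length = 31 := rfl
  have hm : coverDen.length ≤ 31 := by decide
  have hm' : dualDen.length ≤ 31 := by decide
  have : Fact (Nat.Prime 4759) := ⟨by norm_num⟩
  have : Fact (Nat.Prime 653) := ⟨by norm_num⟩
  have : Fact (Nat.Prime 17) := ⟨by norm_num⟩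
  have : Fact (Nat.Prime 7) := ⟨by norm_num⟩
  obtain ⟨k, _, _, r, -, hr, -⟩ := exists_specialization K E 4759 2077
  obtain ⟨eX, heX⟩ := exists_labelling hr hl hm hs isRootTable_pointTable
  obtain ⟨eY, heY⟩ := exists_labelling hr hl' hm' hs' isRootTable_hyperplaneTable
  have h := isProjectiveLabelling_of_isIncidenceTable K heX heY ev₂_incidence_mul_ev₂_coincidence
    isIncidenceTable_pointTable_hyperplaneTable
  have hcard : Nat.card (IntegralRoot E (pencil coverNum coverDen)) = 31 := by
    rw [← Nat.card_congr eX, card_ne_zero]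
  have := isPretransitive_of_specialization K hl hm hs 7 1 sepCheck_bezout7 hcard
    checkRows_frobeniusRows7 checkChain_frobeniusChain7 rfl evMod_coverNum7
  obtain ⟨τ, hτ, x₁, hx₁⟩ := exists_card_fixed K hl hm hs 653 287 sepCheck_bezout653 hcard
    (by norm_num) card_roots653
  obtain ⟨u, x₀, hu, hu5, hfree⟩ := exists_smul_eq_and_pow_smul_eq K hl hm hs 17 1
    sepCheck_bezout17 checkRows_frobeniusRows17 checkChain_frobeniusChain17 evMod_coverNum17
    ev₂Mod_incidence17 (pencil dualNum dualDen)
  exact ⟨h.toSL, h.toSL_surjective τ hτ ⟨x₁, hx₁⟩ u x₀ hu hu5 hfree, h.toSL_eq_one_iff⟩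

end GaloisGroup

theorem nonempty_mulEquiv_of_surjective {G A B : Type*} [Group G] [Group A] [Group B] {f : G →* A}
    {g : G →* B} (hf : Function.Surjective f) (hg : Function.Surjective g)
    (h : ∀ x, f x = 1 ↔ g x = 1) : Nonempty (A ≃* B) :=
  ⟨(QuotientGroup.quotientKerEquivOfSurjective f hf).symm.trans
    ((QuotientGroup.quotientMulEquivOfEq (Subgroup.ext h)).trans
      (QuotientGroup.quotientKerEquivOfSurjective g hg))⟩

theorem restrict_eq_one_iff {F E : Type*} [Field F] [Field E] [Algebra F E] (p : F[X])
    [Fact ((p.map (algebraMap F E)).Splits)] (σ : E ≃ₐ[F] E) :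
    Gal.restrict p E σ = 1 ↔ ∀ x ∈ p.rootSet E, σ x = x := by
  rw [← map_eq_one_iff _ (Gal.galActionHom_injective p E), Equiv.ext_iff, Subtype.forall]
  refine forall₂_congr fun x hx ↦ ?_
  rw [Subtype.ext_iff, Gal.galActionHom_restrict]
  rfl

theorem center_specialLinearGroup_eq_bot :
    Subgroup.center (Matrix.SpecialLinearGroup (Fin 5) (ZMod 2)) = ⊥ := by
  rw [eq_bot_iff]
  intro A hA
  obtain ⟨r, hr, hA⟩ := Matrix.SpecialLinearGroup.mem_center_iff.1 hA
  have key : ∀ r : ZMod 2, r ^ Fintype.card (Fin 5) = 1 → r = 1 := by decide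
  rw [Subgroup.mem_bot]
  ext i j
  rw [← hA, key r hr]
  simp

theorem coe_aeval_integralClosure {R E : Type*} [CommRing R] [CommRing E] [Algebra R E] (h : R[X])
    (x : integralClosure R E) : (aeval x h : integralClosure R E) = aeval (x : E) h :=
  (aeval_algebraMap_apply E x h).symm

theorem nonempty_gal_mulEquiv {K : Type*} [Field K] [CharZero K] [Algebra ℤ[X] K]
    [IsFractionRing ℤ[X] K] {f : K[X]}
    (hf : f = (pencil coverNum coverDen).map (algebraMap ℤ[X] K)) :
    Nonempty (f.Gal ≃* Matrix.ProjectiveSpecialLinearGroup (Fin 5) (ZMod 2)) := by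
  have hmon : (pencil coverNum coverDen).Monic := monic_pencil rfl (by decide)
  have hmon' : (pencil dualNum dualDen).Monic := monic_pencil rfl (by decide)
  let g := (pencil dualNum dualDen).map (algebraMap ℤ[X] K)
  let E := (f * g).SplittingField
  have hf0 : f ≠ 0 := hf ▸ (hmon.map _).ne_zero
  have hg0 : g ≠ 0 := (hmon'.map _).ne_zero
  have hE : (f.map (algebraMap K E)).Splits ∧ (g.map (algebraMap K E)).Splits := by
    have := SplittingField.splits (f * g)
    rw [Polynomial.map_mul] at this
    exact (splits_mul (map_ne_zero hf0) (map_ne_zero hg0)).1 this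
  have : Normal K E := Normal.of_isSplittingField (f * g)
  have : IsGalois K E := ⟨⟩
  have : FaithfulSMul ℤ[X] E := by
    rw [faithfulSMul_iff_algebraMap_injective, IsScalarTower.algebraMap_eq ℤ[X] K E]
    exact (algebraMap K E).injective.comp (IsFractionRing.injective ℤ[X] K)
  have hs : ((pencil coverNum coverDen).map (algebraMap ℤ[X] E)).Splits := by
    rw [IsScalarTower.algebraMap_eq ℤ[X] K E, ← map_map, ← hf]
    exact hE.1
  have hs' : ((pencil dualNum dualDen).map (algebraMap ℤ[X] E)).Splits := by
    rw [IsScalarTower.algebraMap_eq ℤ[X] K E, ← map_map]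
    exact hE.2
  have : Fact ((f.map (algebraMap K E)).Splits) := ⟨hE.1⟩
  obtain ⟨φ, hφ, hφ1⟩ := exists_surjective_specialLinearGroup K hs hs'
  have hker (σ) : Gal.restrict f E σ = 1 ↔ φ σ = 1 := by
    rw [restrict_eq_one_iff, hφ1]
    have hroot (x : E) : x ∈ f.rootSet E ↔ aeval x (pencil coverNum coverDen) = 0 := by
      rw [mem_rootSet_of_ne hf0, ← aeval_map_algebraMap K x (pencil coverNum coverDen), ← hf]
    simp only [hroot]
    constructor
    · intro h x
      apply Subtype.ext
      apply Subtype.ext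
      exact h _ (by rw [← coe_aeval_integralClosure, x.2]; rfl)
    · intro h x hx
      have hint : x ∈ integralClosure ℤ[X] E := ⟨_, hmon, hx⟩
      have := h ⟨⟨x, hint⟩, by apply Subtype.ext; rw [coe_aeval_integralClosure, hx]; rfl⟩
      exact congrArg (fun s ↦ (s.1 : E)) this
  obtain ⟨e⟩ := nonempty_mulEquiv_of_surjective (Gal.restrict_surjective f E) hφ hker
  exact ⟨e.trans ((QuotientGroup.quotientBot.symm).trans
    (QuotientGroup.quotientMulEquivOfEq center_specialLinearGroup_eq_bot.symm))⟩

theorem isFractionRing_ratFunc [Algebra ℤ[X] (RatFunc ℚ)]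
    (h : algebraMap ℤ[X] (RatFunc ℚ) =
      (algebraMap ℚ[X] (RatFunc ℚ)).comp (mapRingHom (Int.castRingHom ℚ))) :
    IsFractionRing ℤ[X] (RatFunc ℚ) := by
  have hinj : Function.Injective (algebraMap ℤ[X] (RatFunc ℚ)) := by
    rw [h]
    exact (IsFractionRing.injective ℚ[X] (RatFunc ℚ)).comp
      (map_injective _ (RingHom.injective_int _))
  have : FaithfulSMul ℤ[X] (RatFunc ℚ) := (faithfulSMul_iff_algebraMap_injective _ _).2 hinj
  have key (q : ℚ[X]) : ∃ (b : ℤ) (p : ℤ[X]), b ≠ 0 ∧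
      algebraMap ℤ[X] (RatFunc ℚ) (C b) * algebraMap ℚ[X] (RatFunc ℚ) q = algebraMap _ _ p := by
    obtain ⟨b, hb⟩ := IsLocalization.integerNormalization_spec (nonZeroDivisors ℤ) q
    refine ⟨b, IsLocalization.integerNormalization (nonZeroDivisors ℤ) q,
      nonZeroDivisors.ne_zero hb.1, ?_⟩
    rw [h, RingHom.comp_apply, RingHom.comp_apply, ← map_mul]
    congr 1
    refine Eq.trans ?_ hb.2.symm
    simp [Algebra.smul_def]
  refine IsFractionRing.of_field _ _ fun z ↦ ?_
  obtain ⟨p, q, hq, rfl⟩ := IsFractionRing.div_surjective (A := ℚ[X]) z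
  obtain ⟨b, P, hb, hP⟩ := key p
  obtain ⟨c, Q, hc, hQ⟩ := key q
  have hb' : algebraMap ℤ[X] (RatFunc ℚ) (C b) ≠ 0 := by
    simpa using (map_ne_zero_iff _ hinj).2 (C_ne_zero.2 hb)
  have hc' : algebraMap ℤ[X] (RatFunc ℚ) (C c) ≠ 0 := by
    simpa using (map_ne_zero_iff _ hinj).2 (C_ne_zero.2 hc)
  have hq' : algebraMap ℚ[X] (RatFunc ℚ) q ≠ 0 := by
    simpa using nonZeroDivisors.ne_zero hq
  refine ⟨C c * P, C b * Q, ?_⟩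
  rw [map_mul, map_mul, ← hP, ← hQ]
  field_simp

theorem ev_coverNum {R : Type*} [CommRing R] (x : R) : x ^ 31 + ev coverNum x =
    (x^5 - 95*x^4 - 110*x^3 - 150*x^2 - 75*x - 3)^3 *
      (x^5 + 4*x^4 - 38*x^3 + 56*x^2 + 53*x - 4)^3 * (x - 3) := by
  simp only [coverNum, ev_cons, ev_nil]
  push_cast
  ring

theorem ev_coverDen {R : Type*} [CommRing R] (x : R) :
    ev coverDen x = (x^2 - 6*x - 1)^8 * (x^2 - x - 1)^4 * (x + 2)^4 * x := by
  simp only [coverDen, ev_cons, ev_nil]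
  push_cast
  ring

/-- The polynomial `f̃(x, t)` has degree 31 in `x` and its Galois group over
`ℚ(t)` is isomorphic to `PSL₅(𝔽₂)`, the projective special linear group of degree 5 over the
field with two elements. -/
theorem galoisGroup_fTilde_eq_PSL52 :
    fTilde.natDegree = 31 ∧
    Nonempty (fTilde.Gal ≃* Matrix.ProjectiveSpecialLinearGroup (Fin 5) (ZMod 2)) := by
  let := ((algebraMap ℚ[X] (RatFunc ℚ)).comp (mapRingHom (Int.castRingHom ℚ))).toAlgebra
  have := isFractionRing_ratFunc rfl
  have hX : algebraMap ℤ[X] (RatFunc ℚ) X = RatFunc.X := by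
    change algebraMap ℚ[X] (RatFunc ℚ) (mapRingHom (Int.castRingHom ℚ) X) = _
    rw [coe_mapRingHom, map_X, RatFunc.algebraMap_X]
  have h : fTilde = (pencil coverNum coverDen).map (algebraMap ℤ[X] (RatFunc ℚ)) := by
    rw [map_pencil, hX, fTilde, ev_coverDen, ← ev_coverNum]
    ring
  refine ⟨?_, nonempty_gal_mulEquiv h⟩
  rw [h, (monic_pencil rfl (by decide)).natDegree_map, natDegree_pencil rfl (by decide)]

end PSL52Family
end
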